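/- arXiv:1608.08152 — 6 statements merged into one kernel-verified Lean document; each statement's English description precedes it below -/
import Mathlib

section
/- Let G be a supersolvable group, H a subgroup of G, and χ : H →* ℂˣ a character such that the induced representation Ind_H^G(χ) is Schur irreducible. Then Ind_H^G(χ) is a simple ℂ[G]-module. -/
open scoped TensorProduct

/-- A group is supersolvable if it has a finite chain of subgroups, each normal in `G`,
going from `⊤` down to `⊥`, with each successive quotient cyclic (equivalently, each
step is generated over the next one by a single element). -/
def IsSupersolvable (G : Type*) [Group G] : Prop :=
  ∃ (k : ℕ) (N : ℕ → Subgroup G),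
    N 0 = ⊤ ∧ N (k + 1) = ⊥ ∧
    (∀ i, N (i + 1) ≤ N i) ∧
    (∀ i, (N i).Normal) ∧
    (∀ i ≤ k, ∃ g : G, N i = N (i + 1) ⊔ Subgroup.closure {g})

/-- `Ind_H^G χ = ℂ[G] ⊗_{ℂ[H]} ℂ_χ`, realized as the quotient of `ℂ[G]` by the left
`ℂ[G]`-submodule generated by the elements `h - χ(h)·1` for `h ∈ H`. -/
noncomputable abbrev IndChar {G : Type*} [Group G] (H : Subgroup G) (χ : H →* ℂˣ) :=
  MonoidAlgebra ℂ G ⧸ Submodule.span (MonoidAlgebra ℂ G)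
    {x : MonoidAlgebra ℂ G | ∃ h : H,
      x = MonoidAlgebra.single (h : G) (1 : ℂ) - (χ h : ℂ) • (1 : MonoidAlgebra ℂ G)}

/-- A `ℂ[G]`-module is Schur irreducible if every `ℂ[G]`-linear endomorphism of it is
multiplication by a complex scalar. -/
def SchurIrreducible (G : Type*) [Group G] (V : Type*) [AddCommGroup V] [Module ℂ V]
    [Module (MonoidAlgebra ℂ G) V] [IsScalarTower ℂ (MonoidAlgebra ℂ G) V] : Prop :=
  ∀ f : V →ₗ[MonoidAlgebra ℂ G] V, ∃ c : ℂ, ∀ v : V, f v = c • v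

open scoped Pointwise

section Group

variable {Q : Type*} [Group Q]

lemma conj_conj_eq_of_conj_eq {c x : Q} (hc : ∀ x : Q, ∃ j : ℤ, x * c * x⁻¹ = c ^ j) {j : ℤ}
    (hx : x * c * x⁻¹ = c ^ j) (y : Q) : (y * x * y⁻¹) * c * (y * x * y⁻¹)⁻¹ = c ^ j := by
  obtain ⟨l, hl⟩ := hc y⁻¹
  have h1 : x * c ^ l * x⁻¹ = (c ^ l) ^ j := by
    rw [← conj_zpow, hx, ← zpow_mul, ← zpow_mul, mul_comm]
  calc (y * x * y⁻¹) * c * (y * x * y⁻¹)⁻¹ = y * (x * (y⁻¹ * c * y⁻¹⁻¹) * x⁻¹) * y⁻¹ := by group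
    _ = (y * c ^ l * y⁻¹) ^ j := by rw [hl, h1, conj_zpow]
    _ = c ^ j := by rw [← hl]; group

/-- If `c` generates a normal subgroup and the exponents of the powers of `c` lying in `K` are
the multiples of `p`, prime or zero, then the kernel of the action of `K` on `⟨c⟩ / ⟨c ^ p⟩` is
a normal subgroup of finite index in `K`, and `K` is malnormal in `K ⊔ ⟨c⟩` modulo it. -/
lemma exists_malnormal_kernel (K : Subgroup Q) (c : Q) (hc : ∀ x : Q, ∃ j : ℤ, x * c * x⁻¹ = c ^ j)
    (p : ℕ) (hp : p.Prime ∨ p = 0) (hpK : ∀ j : ℤ, c ^ j ∈ K ↔ (p : ℤ) ∣ j) :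
    ∃ K₀ ≤ K, (∀ t ∈ K ⊔ Subgroup.zpowers c, ∀ x ∈ K₀, t * x * t⁻¹ ∈ K₀) ∧ K₀.relIndex K ≠ 0 ∧
      ∀ t ∈ K ⊔ Subgroup.zpowers c, t ∉ K → ∀ x ∈ K, t⁻¹ * x * t ∈ K → x ∈ K₀ := by
  have hnormal : (Subgroup.zpowers c).Normal := by
    refine ⟨fun n hn g ↦ ?_⟩
    obtain ⟨i, rfl⟩ := hn
    obtain ⟨j, hj⟩ := hc g
    exact ⟨j * i, by simp only [← conj_zpow, hj, zpow_mul]⟩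
  let K₀ : Subgroup Q := K ⊓ K.map (MulAut.conj c).toMonoidHom
  have hmem (x : Q) : x ∈ K₀ ↔ x ∈ K ∧ c⁻¹ * x * c ∈ K := by
    refine and_congr_right fun _ ↦ ⟨?_, fun h ↦ ⟨_, h, by simp [mul_assoc]⟩⟩
    rintro ⟨y, hy, rfl⟩
    simpa [mul_assoc] using hy
  have hmem' (x : Q) (j : ℤ) (hj : x * c * x⁻¹ = c ^ j) :
      x ∈ K₀ ↔ x ∈ K ∧ (p : ℤ) ∣ j - 1 := by
    rw [hmem]
    refine and_congr_right fun hx ↦ ?_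
    have : c⁻¹ * x * c = c ^ (j - 1) * x := by
      rw [sub_eq_neg_add, zpow_add, ← hj]; group
    rw [this, Subgroup.mul_mem_cancel_right _ hx, hpK]
  have hK (y x : Q) (hx : x ∈ K₀) (hy : y * x * y⁻¹ ∈ K) : y * x * y⁻¹ ∈ K₀ := by
    obtain ⟨j, hj⟩ := hc x
    exact (hmem' _ j (conj_conj_eq_of_conj_eq hc hj y)).2 ⟨hy, ((hmem' x j hj).1 hx).2⟩
  refine ⟨K₀, inf_le_left, ?_, ?_, ?_⟩
  · have hc' (i : ℤ) (x : Q) (hx : x ∈ K₀) : c ^ i * x * (c ^ i)⁻¹ ∈ K := by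
      obtain ⟨j, hj⟩ := hc x
      have h := (hmem' x j hj).1 hx
      have : c ^ i * x * (c ^ i)⁻¹ = c ^ (i - j * i) * x := by
        have : (c ^ j) ^ (-i) = x * (c ^ i)⁻¹ * x⁻¹ := by rw [← hj, conj_zpow, zpow_neg]
        rw [sub_eq_add_neg, ← mul_neg, zpow_add, zpow_mul, this]; group
      rw [this]
      refine mul_mem ((hpK _).2 ?_) h.1
      rw [show i - j * i = -(j - 1) * i by ring]
      exact (h.2.neg_right).mul_right _
    intro t ht x hx
    obtain ⟨y, hy, z, ⟨i, rfl⟩, rfl⟩ := Subgroup.mem_sup_of_normal_right.1 ht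
    have h1 := hK _ _ hx (hc' i x hx)
    have h2 := hK y _ h1 (mul_mem (mul_mem hy h1.1) (inv_mem hy))
    convert h2 using 1
    simp only [mul_inv_rev, mul_assoc]
  · have hst : K₀.subgroupOf K = MulAction.stabilizer K ((c : Q) : Q ⧸ K) := by
      ext x
      rw [Subgroup.mem_subgroupOf, hmem, MulAction.mem_stabilizer_iff, eq_comm (b := (c : Q ⧸ K))]
      change _ ↔ ((c : Q) : Q ⧸ K) = (((x : Q) * c : Q) : Q ⧸ K)
      rw [QuotientGroup.eq, mul_assoc]
      simp
    rw [Subgroup.relIndex, hst, MulAction.index_stabilizer]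
    have hfin : (MulAction.orbit K ((c : Q) : Q ⧸ K)).Finite := by
      have horb (x : K) (j : ℤ) (hj : (x : Q) * c * (x : Q)⁻¹ = c ^ j) :
          x • ((c : Q) : Q ⧸ K) = ((c ^ j : Q) : Q ⧸ K) := by
        change (((x : Q) * c : Q) : Q ⧸ K) = _
        rw [← hj, eq_comm, QuotientGroup.eq]
        convert x.2 using 1
        group
      rcases hp with hp | rfl
      · refine ((Set.finite_Ico (0 : ℤ) p).image fun j ↦ ((c ^ j : Q) : Q ⧸ K)).subset ?_
        rintro _ ⟨x, rfl⟩
        obtain ⟨j, hj⟩ := hc x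
        have hp0 : (0 : ℤ) < p := by exact_mod_cast hp.pos
        refine ⟨j % p, ⟨Int.emod_nonneg _ hp0.ne', Int.emod_lt_of_pos _ hp0⟩, ?_⟩
        change _ = x • ((c : Q) : Q ⧸ K)
        rw [horb x j hj]
        change ((c ^ (j % p) : Q) : Q ⧸ K) = _
        rw [QuotientGroup.eq, ← zpow_neg, ← zpow_add, hpK, neg_add_eq_sub]
        exact Int.dvd_self_sub_emod
      · refine ((Set.toFinite {(1 : ℤ), -1}).image fun j ↦ ((c ^ j : Q) : Q ⧸ K)).subset ?_
        rintro _ ⟨x, rfl⟩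
        obtain ⟨j, hj⟩ := hc x
        obtain ⟨i, hi⟩ := hc (x : Q)⁻¹
        refine ⟨j, ?_, (horb x j hj).symm⟩
        have h1 : c ^ (j * i) = c := by
          rw [mul_comm, zpow_mul, ← hi, conj_zpow, ← hj]; group
        have h2 : c ^ (j * i - 1) ∈ K := by
          rw [zpow_sub_one, h1, mul_inv_cancel]; exact one_mem _
        rw [hpK, Nat.cast_zero, zero_dvd_iff, sub_eq_zero] at h2
        exact Int.isUnit_iff.1 (IsUnit.of_mul_eq_one _ h2)
    exact (Set.ncard_pos hfin).2 ⟨_, MulAction.mem_orbit_self _⟩ |>.ne'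
  · intro t ht htK x hx hxt
    obtain ⟨z, ⟨i, rfl⟩, y, hy, rfl⟩ := Subgroup.mem_sup_of_normal_left.1 (sup_comm K _ ▸ ht)
    obtain ⟨j, hj⟩ := hc x
    refine (hmem' x j hj).2 ⟨hx, ?_⟩
    have h1 : ¬ (p : ℤ) ∣ i := fun h ↦ htK (mul_mem ((hpK i).2 h) hy)
    have h2 : c ^ ((j - 1) * i) ∈ K := by
      have h3 : c ^ ((j - 1) * i) = y * ((c ^ i * y)⁻¹ * x * (c ^ i * y)) * y⁻¹ * x⁻¹ := by
        rw [show (j - 1) * i = -i + j * i by ring, zpow_add, zpow_mul, ← hj, conj_zpow]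
        group
      rw [h3]
      exact mul_mem (mul_mem (mul_mem hy hxt) (inv_mem hy)) (inv_mem hx)
    rw [hpK] at h2
    rcases hp with hp | rfl
    · exact ((Nat.prime_iff_prime_int.1 hp).dvd_or_dvd h2).resolve_right h1
    · simp only [Nat.cast_zero, zero_dvd_iff, mul_eq_zero] at h1 h2 ⊢
      exact h2.resolve_right h1

end Group

section Stable

variable {k G M : Type*} [Field k] [Group G] [AddCommGroup M] [Module k M] [DistribMulAction G M]

/-- The subspace `X` is mapped into itself by every element of the subgroup `K`. -/
def IsStableUnder (K : Subgroup G) (X : Submodule k M) : Prop :=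
  ∀ g ∈ K, ∀ x ∈ X, g • x ∈ X

lemma IsStableUnder.inf {K : Subgroup G} {X Y : Submodule k M} (hX : IsStableUnder K X)
    (hY : IsStableUnder K Y) : IsStableUnder K (X ⊓ Y) :=
  fun g hg x hx ↦ ⟨hX g hg x hx.1, hY g hg x hx.2⟩

lemma IsStableUnder.sup {K : Subgroup G} {X Y : Submodule k M} (hX : IsStableUnder K X)
    (hY : IsStableUnder K Y) : IsStableUnder K (X ⊔ Y) := by
  intro g hg x hx
  obtain ⟨y, hy, z, hz, rfl⟩ := Submodule.mem_sup.1 hx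
  rw [smul_add]
  exact Submodule.add_mem_sup (hX g hg y hy) (hY g hg z hz)

lemma IsStableUnder.mono {K K' : Subgroup G} {X : Submodule k M} (hX : IsStableUnder K' X)
    (h : K ≤ K') : IsStableUnder K X :=
  fun g hg ↦ hX g (h hg)

/-- The span of the translates of `e` by the elements of `S`. -/
def translateSpan (k : Type*) {G M : Type*} [Field k] [Group G] [AddCommGroup M] [Module k M]
    [DistribMulAction G M] (e : M) (S : Set G) : Submodule k M :=
  Submodule.span k ((· • e) '' S)

lemma smul_mem_translateSpan {e : M} {S : Set G} {g : G} (hg : g ∈ S) :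
    g • e ∈ translateSpan k e S :=
  Submodule.subset_span ⟨g, hg, rfl⟩

lemma translateSpan_mono {e : M} {S S' : Set G} (h : S ⊆ S') :
    translateSpan k e S ≤ translateSpan k e S' :=
  Submodule.span_mono (Set.image_mono h)

lemma translateSpan_le {e : M} {S : Set G} {X : Submodule k M} (h : ∀ g ∈ S, g • e ∈ X) :
    translateSpan k e S ≤ X :=
  Submodule.span_le.2 (by rintro _ ⟨g, hg, rfl⟩; exact h g hg)

/-- The representation of `K` spanned by the translates of `e` is irreducible. -/
def IrreducibleOn (k : Type*) {G M : Type*} [Field k] [Group G] [AddCommGroup M] [Module k M]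
    [DistribMulAction G M] (e : M) (K : Subgroup G) : Prop :=
  ∀ X ≤ translateSpan k e (K : Set G), IsStableUnder K X → X ≠ ⊥ → e ∈ X

/-- The representation `M` of `G` is induced from the character `χ` of `H`, which is carried by
the line spanned by `e`. -/
structure IsInducedFrom (H : Subgroup G) (χ : H →* kˣ) (e : M) : Prop where
  ne_zero : e ≠ 0
  smul_eq (h : H) : (h : G) • e = (χ h : k) • e
  span_eq_top : translateSpan k e (Set.univ : Set G) = ⊤
  exists_restriction (S : Set G) (hS : ∀ g, ∀ h ∈ H, g * h ∈ S ↔ g ∈ S) :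
    ∃ π : M →ₗ[k] M, ∀ g : G, (g ∈ S → π (g • e) = g • e) ∧ (g ∉ S → π (g • e) = 0)

variable {H K : Subgroup G} {χ : H →* kˣ} {e : M}

lemma IsInducedFrom.exists_mem_translateSpan_preimage (he : IsInducedFrom H χ e) (x : M) :
    ∃ T : Finset (G ⧸ K), x ∈ translateSpan k e (((↑) : G → G ⧸ K) ⁻¹' T) := by
  classical
  have hx : x ∈ translateSpan k e (Set.univ : Set G) := he.span_eq_top ▸ Submodule.mem_top
  induction hx using Submodule.span_induction with
  | mem x hx =>
    obtain ⟨g, -, rfl⟩ := hx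
    exact ⟨{(g : G ⧸ K)}, smul_mem_translateSpan (by simp)⟩
  | zero => exact ⟨∅, zero_mem _⟩
  | add x y _ _ hx hy =>
    obtain ⟨T, hT⟩ := hx
    obtain ⟨T', hT'⟩ := hy
    refine ⟨T ∪ T', add_mem (translateSpan_mono ?_ hT) (translateSpan_mono ?_ hT')⟩ <;>
      exact Set.preimage_mono (by simp)
  | smul a x _ hx =>
    obtain ⟨T, hT⟩ := hx
    exact ⟨T, Submodule.smul_mem _ a hT⟩

open Classical in
/-- The projections onto the blocks indexed by `G ⧸ K`. -/
lemma IsInducedFrom.exists_projection (he : IsInducedFrom H χ e) (hHK : H ≤ K) :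
    ∃ π : G ⧸ K → M →ₗ[k] M, ∀ c (g : G), π c (g • e) = if (g : G ⧸ K) = c then g • e else 0 := by
  have h (c : G ⧸ K) := he.exists_restriction (((↑) : G → G ⧸ K) ⁻¹' {c}) (fun g h hh ↦ by
    simp only [Set.mem_preimage, Set.mem_singleton_iff]
    rw [QuotientGroup.mk_mul_of_mem g (hHK hh)])
  choose π hπ using h
  refine ⟨π, fun c g ↦ ?_⟩
  split_ifs with hg
  · exact (hπ c g).1 hg
  · exact (hπ c g).2 hg

section Projection

open Classical

variable {π : G ⧸ K → M →ₗ[k] M}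

lemma sub_projection_mem (hπ : ∀ c (g : G), π c (g • e) = if (g : G ⧸ K) = c then g • e else 0)
    {T : Finset (G ⧸ K)} (c : G ⧸ K) {x : M}
    (hx : x ∈ translateSpan k e (((↑) : G → G ⧸ K) ⁻¹' T)) :
    x - π c x ∈ translateSpan k e (((↑) : G → G ⧸ K) ⁻¹' (T.erase c)) := by
  refine translateSpan_le (X := (translateSpan k e
    (((↑) : G → G ⧸ K) ⁻¹' (T.erase c))).comap (LinearMap.id - π c)) (fun g hg ↦ ?_) hx
  simp only [Submodule.mem_comap, LinearMap.sub_apply, LinearMap.id_apply, hπ]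
  split_ifs with h
  · simp
  · rw [sub_zero]
    exact smul_mem_translateSpan (by simpa [h] using hg)

lemma projection_eq_zero (hπ : ∀ c (g : G), π c (g • e) = if (g : G ⧸ K) = c then g • e else 0)
    {S : Set G} {c : G ⧸ K} (hS : ∀ s ∈ S, (s : G ⧸ K) ≠ c) {x : M}
    (hx : x ∈ translateSpan k e S) : π c x = 0 := by
  refine translateSpan_le (X := LinearMap.ker (π c)) (fun g hg ↦ ?_) hx
  rw [LinearMap.mem_ker, hπ, if_neg (hS g hg)]

lemma projection_mem (he : IsInducedFrom H χ e)
    (hπ : ∀ c (g : G), π c (g • e) = if (g : G ⧸ K) = c then g • e else 0)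
    (c : G ⧸ K) (x : M) : π c x ∈ translateSpan k e (((↑) : G → G ⧸ K) ⁻¹' {c}) := by
  have hx : x ∈ translateSpan k e (Set.univ : Set G) := he.span_eq_top ▸ Submodule.mem_top
  refine translateSpan_le (X := (translateSpan k e
    (((↑) : G → G ⧸ K) ⁻¹' {c})).comap (π c)) (fun g _ ↦ ?_) hx
  rw [Submodule.mem_comap, hπ]
  split_ifs with h
  · exact smul_mem_translateSpan h
  · exact zero_mem _

lemma projection_projection (he : IsInducedFrom H χ e)
    (hπ : ∀ c (g : G), π c (g • e) = if (g : G ⧸ K) = c then g • e else 0)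
    (c d : G ⧸ K) (x : M) : π c (π d x) = if d = c then π d x else 0 := by
  have hx : x ∈ translateSpan k e (Set.univ : Set G) := he.span_eq_top ▸ Submodule.mem_top
  split_ifs with hdc
  · subst hdc
    refine sub_eq_zero.1 (translateSpan_le (X := LinearMap.ker ((π d).comp (π d) - π d))
      (fun g _ ↦ ?_) hx)
    simp only [LinearMap.mem_ker, LinearMap.sub_apply, LinearMap.comp_apply, hπ]
    split_ifs with h <;> simp [hπ, h]
  · refine projection_eq_zero hπ (fun s hs hsc ↦ hdc ?_) (projection_mem he hπ d x)
    exact (Set.mem_singleton_iff.1 hs).symm.trans hsc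

end Projection

variable [SMulCommClass G k M]

lemma IsStableUnder.smul {K₀ K : Subgroup G} {X : Submodule k M} (hX : IsStableUnder K₀ X)
    (hnorm : ∀ t ∈ K, ∀ x ∈ K₀, t * x * t⁻¹ ∈ K₀) {s : G} (hs : s ∈ K) :
    IsStableUnder K₀ (s • X) := by
  rintro g hg _ ⟨x, hx, rfl⟩
  refine ⟨(s⁻¹ * g * s⁻¹⁻¹) • x, hX _ (hnorm _ (inv_mem hs) g hg) x hx, ?_⟩
  change s • (s⁻¹ * g * s⁻¹⁻¹) • x = g • s • x
  simp only [← mul_smul]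
  congr 1
  group

/-- A weak form of Clifford's theorem: an irreducible representation of a group is semisimple over
each normal subgroup of finite index. -/
lemma exists_stable_complement {K₀ K : Subgroup G}
    (hnorm : ∀ t ∈ K, ∀ x ∈ K₀, t * x * t⁻¹ ∈ K₀) (hfin : K₀.relIndex K ≠ 0)
    {V : Submodule k M} (hV : IsStableUnder K V) (hle : K₀ ≤ K)
    (hirr : ∀ X ≤ V, IsStableUnder K X → X ≠ ⊥ → V ≤ X)
    {Y : Submodule k M} (hY : IsStableUnder K₀ Y) :
    ∃ Z ≤ V, IsStableUnder K₀ Z ∧ Disjoint Y Z ∧ V ≤ Y ⊔ Z := by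
  obtain ⟨Z, -, ⟨hZV, hZ, hYZ⟩, hmax⟩ := zorn_le_nonempty₀
    {Z : Submodule k M | Z ≤ V ∧ IsStableUnder K₀ Z ∧ Disjoint Y Z} (by
      intro C hC hchain Z₀ hZ₀
      have hne : C.Nonempty := ⟨Z₀, hZ₀⟩
      refine ⟨sSup C, ⟨sSup_le fun Z hZ ↦ (hC hZ).1, ?_, ?_⟩, fun Z hZ ↦ le_sSup hZ⟩
      · intro g hg x hx
        obtain ⟨Z, hZ, hxZ⟩ := (Submodule.mem_sSup_of_directed hne hchain.directedOn).1 hx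
        exact le_sSup hZ ((hC hZ).2.1 g hg x hxZ)
      · rw [hchain.directedOn.disjoint_sSup_right]
        exact fun Z hZ ↦ (hC hZ).2.2) ⊥
    ⟨bot_le, fun g _ x hx ↦ by simp_all, disjoint_bot_right⟩
  refine ⟨Z, hZV, hZ, hYZ, ?_⟩
  let E := Y ⊔ Z
  have hE : IsStableUnder K₀ E := hY.sup hZ
  have hess : ∀ X ≤ V, IsStableUnder K₀ X → X ≠ ⊥ → X ⊓ E ≠ ⊥ := by
    intro X hXV hX hX0 hXE
    have hd : Disjoint E X := (disjoint_iff.2 hXE).symm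
    have h := hmax ⟨sup_le hZV hXV, hZ.sup hX, hYZ.disjoint_sup_right_of_disjoint_sup_left hd⟩
      le_sup_left
    exact hX0 (hd.eq_bot_of_ge ((le_sup_right.trans h).trans le_sup_right))
  have hess' (s : G) (hs : s ∈ K) : ∀ X ≤ V, IsStableUnder K₀ X → X ≠ ⊥ → X ⊓ s • E ≠ ⊥ := by
    intro X hXV hX hX0
    obtain ⟨x, hx, hx0⟩ := Submodule.exists_mem_ne_zero_of_ne_bot
      (hess (s⁻¹ • X) (by rintro _ ⟨x, hx, rfl⟩; exact hV _ (inv_mem hs) x (hXV hx))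
        (hX.smul hnorm (inv_mem hs)) fun h ↦ hX0 (by
          rw [← inv_smul_smul s⁻¹ X, h, Submodule.smul_bot']))
    obtain ⟨⟨y, hy, rfl⟩, hxE⟩ := hx
    refine Submodule.ne_bot_iff _ |>.2 ⟨y, ⟨hy, s⁻¹ • y, hxE, smul_inv_smul s y⟩, ?_⟩
    rintro rfl
    exact hx0 (smul_zero _)
  have hess_inf (T : Finset G) (hT : ∀ s ∈ T, s ∈ K) : ∀ X ≤ V, IsStableUnder K₀ X → X ≠ ⊥ →
      X ⊓ T.inf (fun s ↦ s • E) ≠ ⊥ := by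
    classical
    induction T using Finset.induction with
    | empty => simp
    | insert s T _ ih =>
      intro X hXV hX hX0
      rw [Finset.inf_insert, ← inf_assoc]
      exact ih (fun t ht ↦ hT t (Finset.mem_insert_of_mem ht)) _ (inf_le_left.trans hXV)
        (hX.inf (hE.smul hnorm (hT s (Finset.mem_insert_self _ _))))
        (hess' s (hT s (Finset.mem_insert_self _ _)) X hXV hX hX0)
  have hmemE (s t : G) (hst : s⁻¹ * t ∈ K₀) (x : M) (hx : x ∈ s • E) : x ∈ t • E := by
    obtain ⟨y, hy, rfl⟩ := hx
    refine ⟨(s⁻¹ * t)⁻¹ • y, hE _ (inv_mem hst) y hy, ?_⟩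
    change t • (s⁻¹ * t)⁻¹ • y = s • y
    rw [← mul_smul]
    congr 1
    group
  let I : Submodule k M := V ⊓ ⨅ s ∈ K, s • E
  by_cases hV0 : V = ⊥
  · exact hV0 ▸ bot_le
  have hI : I ≠ ⊥ := by
    have : Finite (K ⧸ K₀.subgroupOf K) := Nat.finite_of_card_ne_zero hfin
    classical
    have := Fintype.ofFinite (K ⧸ K₀.subgroupOf K)
    let T : Finset G := Finset.univ.image fun q : K ⧸ K₀.subgroupOf K ↦ (q.out : G)
    have h := hess_inf T (by simp only [T, Finset.mem_image]; rintro _ ⟨q, -, rfl⟩; exact q.out.2)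
      V le_rfl (hV.mono hle) hV0
    obtain ⟨x, hx, hx0⟩ := Submodule.exists_mem_ne_zero_of_ne_bot h
    refine Submodule.ne_bot_iff _ |>.2 ⟨x, ⟨hx.1, ?_⟩, hx0⟩
    simp only [Submodule.mem_iInf, SetLike.mem_coe]
    intro s hs
    let q : K ⧸ K₀.subgroupOf K := ((⟨s, hs⟩ : K) : K ⧸ K₀.subgroupOf K)
    refine hmemE q.out s ?_ x ?_
    · have hq : q.out⁻¹ * ⟨s, hs⟩ ∈ K₀.subgroupOf K := QuotientGroup.eq.1 (QuotientGroup.out_eq' q)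
      exact hq
    · have hq : (q.out : G) ∈ T := Finset.mem_image_of_mem _ (Finset.mem_univ q)
      exact Finset.inf_le (f := fun s ↦ s • E) hq hx.2
  have hIK : IsStableUnder K I := by
    refine fun g hg x hx ↦ ⟨hV g hg x hx.1, ?_⟩
    have hx2 := hx.2
    simp only [Submodule.mem_iInf, SetLike.mem_coe] at hx2 ⊢
    intro s hs
    obtain ⟨y, hy, hyx⟩ := hx2 (g⁻¹ * s) (mul_mem (inv_mem hg) hs)
    refine ⟨y, hy, ?_⟩
    change (g⁻¹ * s) • y = x at hyx
    change s • y = g • x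
    rw [← hyx, ← mul_smul, mul_inv_cancel_left]
  refine (hirr I inf_le_left hIK hI).trans (inf_le_right.trans ?_)
  refine (iInf₂_le 1 (one_mem K)).trans ?_
  rw [one_smul]


lemma smul_mem_translateSpan_of_forall {e : M} {S S' : Set G} {g : G} (h : ∀ s ∈ S, g * s ∈ S')
    {x : M} (hx : x ∈ translateSpan k e S) : g • x ∈ translateSpan k e S' := by
  refine translateSpan_le (X := (translateSpan k e S').comap (DistribSMul.toLinearMap k M g))
    (fun s hs ↦ ?_) hx
  rw [Submodule.mem_comap, DistribSMul.toLinearMap_apply, smul_smul]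
  exact smul_mem_translateSpan (h s hs)

lemma isStableUnder_translateSpan (e : M) (K : Subgroup G) :
    IsStableUnder K (translateSpan k e (K : Set G)) :=
  fun _ hg _ hx ↦ smul_mem_translateSpan_of_forall (fun _ hs ↦ mul_mem hg hs) hx

section Projection

open Classical

variable {π : G ⧸ K → M →ₗ[k] M}

lemma smul_projection (he : IsInducedFrom H χ e)
    (hπ : ∀ c (g : G), π c (g • e) = if (g : G ⧸ K) = c then g • e else 0)
    (g : G) (c : G ⧸ K) (x : M) : g • π c x = π (g • c) (g • x) := by
  have hx : x ∈ translateSpan k e (Set.univ : Set G) := he.span_eq_top ▸ Submodule.mem_top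
  refine sub_eq_zero.1 (translateSpan_le (X := LinearMap.ker
    ((DistribSMul.toLinearMap k M g).comp (π c) - (π (g • c)).comp (DistribSMul.toLinearMap k M g)))
    (fun s _ ↦ ?_) hx)
  simp only [LinearMap.mem_ker, LinearMap.sub_apply, LinearMap.comp_apply,
    DistribSMul.toLinearMap_apply, hπ, smul_smul g s e]
  have : ((g * s : G) : G ⧸ K) = g • c ↔ (s : G ⧸ K) = c := by
    change g • (s : G ⧸ K) = g • c ↔ _
    exact smul_left_cancel_iff g
  simp only [this]
  split_ifs <;> simp [smul_smul]

end Projection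

/-- The `K`-equivariant extension of a `K₀`-equivariant map, obtained by averaging it over the
cosets of `K₀` in `K`. -/
noncomputable def cosetAverage (K₀ K : Subgroup G) [Fintype (K ⧸ K₀.subgroupOf K)] (φ : M → M)
    (v : M) : M :=
  ∑ q : K ⧸ K₀.subgroupOf K, (q.out : G) • φ ((q.out : G)⁻¹ • v)

omit [SMulCommClass G k M] in
lemma smul_inv_smul_eq_of_mk_eq {K₀ K : Subgroup G} {V : Submodule k M} (hV : IsStableUnder K V)
    {φ : M → M} (hφ : ∀ x ∈ K₀, ∀ v ∈ V, φ (x • v) = x • φ v) {v : M} (hv : v ∈ V) {s s' : K}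
    (hs : (s : K ⧸ K₀.subgroupOf K) = s') :
    (s : G) • φ ((s : G)⁻¹ • v) = (s' : G) • φ ((s' : G)⁻¹ • v) := by
  have hmem : (s : G)⁻¹ * s' ∈ K₀ := by
    have h : s⁻¹ * s' ∈ K₀.subgroupOf K := QuotientGroup.eq.1 hs
    exact h
  have h := hφ _ hmem ((s' : G)⁻¹ • v) (hV _ (inv_mem s'.2) v hv)
  rw [smul_smul, mul_inv_cancel_right] at h
  rw [h, smul_smul, mul_inv_cancel_left]

omit [SMulCommClass G k M] in
lemma smul_cosetAverage {K₀ K : Subgroup G} [Fintype (K ⧸ K₀.subgroupOf K)] {V : Submodule k M}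
    (hV : IsStableUnder K V) {φ : M → M} (hφ : ∀ x ∈ K₀, ∀ v ∈ V, φ (x • v) = x • φ v)
    (s : K) {v : M} (hv : v ∈ V) :
    (s : G) • cosetAverage K₀ K φ v = cosetAverage K₀ K φ ((s : G) • v) := by
  rw [cosetAverage, cosetAverage, Finset.smul_sum]
  refine Fintype.sum_equiv (MulAction.toPerm s) _ _ fun q ↦ ?_
  have h : ((s * q.out : K) : K ⧸ K₀.subgroupOf K) = ((s • q).out : K) := by
    rw [QuotientGroup.out_eq']
    conv_rhs => rw [← QuotientGroup.out_eq' q]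
    rfl
  have h2 := smul_inv_smul_eq_of_mk_eq hV hφ (hV s s.2 v hv) h
  rw [MulAction.toPerm_apply, ← h2]
  simp [smul_smul, mul_assoc]

open Classical in
/-- Irreducibility passes from `K` to a larger subgroup `K'` in which `K` is malnormal modulo a
normal subgroup of finite index in `K`. -/
lemma IsInducedFrom.irreducibleOn_of_malnormal (he : IsInducedFrom H χ e)
    (hschur : ∀ m : M, (∀ h : H, (h : G) • m = (χ h : k) • m) → ∃ a : k, m = a • e)
    {K₀ K K' : Subgroup G} (hHK : H ≤ K) (hKK' : K ≤ K') (hle : K₀ ≤ K)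
    (hnorm : ∀ t ∈ K', ∀ x ∈ K₀, t * x * t⁻¹ ∈ K₀) (hfin : K₀.relIndex K ≠ 0)
    (hmal : ∀ t ∈ K', t ∉ K → ∀ x ∈ K, t⁻¹ * x * t ∈ K → x ∈ K₀)
    (hK : IrreducibleOn k e K) : IrreducibleOn k e K' := by
  intro X hXV hX hX0
  obtain ⟨π, hπ⟩ := he.exists_projection hHK
  have hV := isStableUnder_translateSpan (k := k) e K
  have hsmul_mk (x : G) (hx : x ∈ K₀) (t : G) (ht : t ∈ K') :
      x • (t : G ⧸ K) = (t : G ⧸ K) := by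
    change ((x * t : G) : G ⧸ K) = t
    refine (QuotientGroup.eq.2 (hle ?_)).symm
    simpa [mul_assoc] using hnorm t⁻¹ (inv_mem ht) x hx
  have hex : ∃ n, ∃ T : Finset (G ⧸ K), T.card = n ∧
      X ⊓ translateSpan k e (((↑) : G → G ⧸ K) ⁻¹' T) ≠ ⊥ := by
    obtain ⟨x, hx, hx0⟩ := Submodule.exists_mem_ne_zero_of_ne_bot hX0
    obtain ⟨T, hT⟩ := he.exists_mem_translateSpan_preimage (K := K) x
    exact ⟨_, T, rfl, (Submodule.ne_bot_iff _).2 ⟨x, ⟨hx, hT⟩, hx0⟩⟩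
  have hmin (T : Finset (G ⧸ K)) (hT : T.card = Nat.find hex) (c) (hc : c ∈ T) (x : M) (hx : x ∈ X)
      (hxT : x ∈ translateSpan k e (((↑) : G → G ⧸ K) ⁻¹' T)) (h0 : π c x = 0) : x = 0 := by
    by_contra hx0
    refine Nat.find_min hex (m := (T.erase c).card) ?_
      ⟨_, rfl, (Submodule.ne_bot_iff _).2 ⟨x, ⟨hx, ?_⟩, hx0⟩⟩
    · rw [← hT]; exact Finset.card_erase_lt_of_mem hc
    · simpa [h0] using sub_projection_mem hπ c hxT
  have hrep (T : Finset (G ⧸ K)) (hT : T.card = Nat.find hex) (x : M) (hx : x ∈ X)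
      (hxT : x ∈ translateSpan k e (((↑) : G → G ⧸ K) ⁻¹' T)) (hx0 : x ≠ 0) (c) (hc : c ∈ T) :
      ∃ t ∈ K', (t : G ⧸ K) = c := by
    by_contra! h
    exact hx0 (hmin T hT c hc x hx hxT (projection_eq_zero hπ h (hXV hx)))
  obtain ⟨T, hT, h1T, w, hwX, hwT, hw0⟩ : ∃ T : Finset (G ⧸ K), T.card = Nat.find hex ∧
      ((1 : G) : G ⧸ K) ∈ T ∧
      ∃ w ∈ X, w ∈ translateSpan k e (((↑) : G → G ⧸ K) ⁻¹' T) ∧ w ≠ 0 := by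
    obtain ⟨T, hT, hXT⟩ := Nat.find_spec hex
    obtain ⟨x, ⟨hx, hxT⟩, hx0⟩ := Submodule.exists_mem_ne_zero_of_ne_bot hXT
    have hne : T.Nonempty := by
      rw [Finset.nonempty_iff_ne_empty]
      rintro rfl
      simp [translateSpan] at hxT
      exact hx0 hxT
    obtain ⟨c, hc⟩ := hne
    obtain ⟨t, ht, rfl⟩ := hrep T hT x hx hxT hx0 c hc
    refine ⟨T.image (t⁻¹ • ·), ?_, ?_, t⁻¹ • x, hX _ (inv_mem ht) x hx, ?_, ?_⟩
    · rw [Finset.card_image_of_injective _ (MulAction.injective _), hT]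
    · refine Finset.mem_image.2 ⟨_, hc, ?_⟩
      change ((t⁻¹ * t : G) : G ⧸ K) = _
      rw [inv_mul_cancel]
    · refine smul_mem_translateSpan_of_forall (fun s hs ↦ ?_) hxT
      exact Finset.mem_coe.2 (Finset.mem_image.2 ⟨_, hs, rfl⟩)
    · rwa [ne_eq, smul_eq_zero_iff_eq]
  by_cases hone : ∀ c ∈ T, c = ((1 : G) : G ⧸ K)
  · have hwK : w ∈ translateSpan k e (K : Set G) := by
      refine translateSpan_mono (fun g hg ↦ ?_) hwT
      simpa using QuotientGroup.eq.1 (hone _ hg).symm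
    exact (hK (X ⊓ translateSpan k e (K : Set G)) inf_le_right ((hX.mono hKK').inf hV)
      ((Submodule.ne_bot_iff _).2 ⟨w, ⟨hwX, hwK⟩, hw0⟩)).1
  push Not at hone
  obtain ⟨c, hcT, hc1⟩ := hone
  obtain ⟨t, ht, rfl⟩ := hrep T hT w hwX hwT hw0 c hcT
  have htK : t ∉ K := fun h ↦ hc1 (QuotientGroup.eq.2 (by simpa using h))
  let Z : Submodule k M := X ⊓ translateSpan k e (((↑) : G → G ⧸ K) ⁻¹' T)
  have hinj (c) (hc : c ∈ T) (z : M) (hz : z ∈ Z) (h0 : π c z = 0) : z = 0 :=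
    hmin T hT c hc z hz.1 hz.2 h0
  have hZ : IsStableUnder K₀ Z := by
    refine (hX.mono (hle.trans hKK')).inf fun x hx z hz ↦
      smul_mem_translateSpan_of_forall (fun s hs ↦ ?_) hz
    obtain ⟨s', hs', hss'⟩ := hrep T hT w hwX hwT hw0 s hs
    change x • (s : G ⧸ K) ∈ T
    rw [← hss', hsmul_mk x hx s' hs', hss']
    exact hs
  have hY : IsStableUnder K₀ (Z.map (π ((1 : G) : G ⧸ K))) := by
    rintro x hx _ ⟨z, hz, rfl⟩
    refine ⟨x • z, hZ x hx z hz, ?_⟩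
    rw [smul_projection he hπ, hsmul_mk x hx 1 (one_mem _)]
  have heK : e ∈ translateSpan k e (K : Set G) := by
    simpa using smul_mem_translateSpan (k := k) (e := e) (one_mem K : (1 : G) ∈ (K : Set G))
  obtain ⟨Y', -, hY', hdisj, hsup⟩ := exists_stable_complement
    (fun t ht ↦ hnorm t (hKK' ht)) hfin hV hle (fun X hXV hX hX0 ↦ translateSpan_le fun g hg ↦
      hX g hg e (hK X hXV hX hX0)) hY
  have hζ : ∀ v, ∃ z, v ∈ translateSpan k e (K : Set G) →
      z ∈ Z ∧ v - π ((1 : G) : G ⧸ K) z ∈ Y' := by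
    intro v
    by_cases hv : v ∈ translateSpan k e (K : Set G)
    · obtain ⟨_, ⟨z, hz, rfl⟩, y, hy, rfl⟩ := Submodule.mem_sup.1 (hsup hv)
      exact ⟨z, fun _ ↦ ⟨hz, by simpa using hy⟩⟩
    · exact ⟨0, fun h ↦ absurd h hv⟩
  choose ζ hζ using hζ
  have huniq (v : M) (hv : v ∈ translateSpan k e (K : Set G)) (z : M) (hz : z ∈ Z)
      (hvz : v - π ((1 : G) : G ⧸ K) z ∈ Y') : ζ v = z := by
    refine sub_eq_zero.1 (hinj _ h1T _ (sub_mem (hζ v hv).1 hz) ?_)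
    refine (Submodule.disjoint_def.1 hdisj) _ ⟨_, sub_mem (hζ v hv).1 hz, rfl⟩ ?_
    rw [map_sub]
    simpa using sub_mem hvz (hζ v hv).2
  have hζ_smul (x : G) (hx : x ∈ K₀) (v : M) (hv : v ∈ translateSpan k e (K : Set G)) :
      π (t : G ⧸ K) (ζ (x • v)) = x • π (t : G ⧸ K) (ζ v) := by
    rw [smul_projection he hπ, hsmul_mk x hx t ht,
      huniq (x • v) (hV x (hle hx) v hv) _ (hZ x hx _ (hζ v hv).1)]
    have h := hY' x hx _ (hζ v hv).2
    rwa [smul_sub, smul_projection he hπ, hsmul_mk x hx 1 (one_mem _)] at h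
  have hζ_smul' (a : k) (v : M) (hv : v ∈ translateSpan k e (K : Set G)) : ζ (a • v) = a • ζ v := by
    refine huniq _ (Submodule.smul_mem _ a hv) _ (Submodule.smul_mem _ a (hζ v hv).1) ?_
    rw [map_smul, ← smul_sub]
    exact Submodule.smul_mem _ a (hζ v hv).2
  have : Finite (K ⧸ K₀.subgroupOf K) := Nat.finite_of_card_ne_zero hfin
  have := Fintype.ofFinite (K ⧸ K₀.subgroupOf K)
  let f : M → M := cosetAverage K₀ K fun v ↦ π (t : G ⧸ K) (ζ v)
  have hf_smul (s : K) (v : M) (hv : v ∈ translateSpan k e (K : Set G)) :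
      (s : G) • f v = f ((s : G) • v) := smul_cosetAverage hV hζ_smul s hv
  have hfe : f e = 0 := by
    obtain ⟨a, ha⟩ := hschur (f e) (fun h ↦ by
      rw [hf_smul ⟨h, hHK h.2⟩ e heK, he.smul_eq]
      simp only [f, cosetAverage, Finset.smul_sum]
      refine Finset.sum_congr rfl fun q _ ↦ ?_
      rw [smul_comm _ (χ h : k) e, hζ_smul' _ _ (hV _ (inv_mem q.out.2) e heK), map_smul,
        smul_comm])
    have h0 : π ((1 : G) : G ⧸ K) (f e) = 0 := by
      simp only [f, cosetAverage, map_sum]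
      refine Finset.sum_eq_zero fun q _ ↦ ?_
      have hq : ((1 : G) : G ⧸ K) = (q.out : G) • ((1 : G) : G ⧸ K) := by
        change _ = (((q.out : G) * 1 : G) : G ⧸ K)
        exact QuotientGroup.eq.2 (by simp)
      rw [hq, ← smul_projection he hπ, projection_projection he hπ, if_neg hc1, smul_zero]
    have h1 : π ((1 : G) : G ⧸ K) e = e := by simpa using hπ ((1 : G) : G ⧸ K) 1
    rw [ha, map_smul, h1] at h0
    rw [ha, h0]
  have hf (v : M) (hv : v ∈ translateSpan k e (K : Set G)) :
      π (t : G ⧸ K) (f v) = π (t : G ⧸ K) (ζ v) := by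
    simp only [f, cosetAverage, map_sum]
    rw [Finset.sum_eq_single ((1 : K) : K ⧸ K₀.subgroupOf K)]
    · have h1 := smul_inv_smul_eq_of_mk_eq (φ := fun v ↦ π (t : G ⧸ K) (ζ v)) hV hζ_smul hv
        (QuotientGroup.out_eq' ((1 : K) : K ⧸ K₀.subgroupOf K))
      simp only [OneMemClass.coe_one, inv_one, one_smul] at h1
      rw [h1, projection_projection he hπ, if_pos rfl]
    · intro q _ hq
      have hq' : ((q.out : G)⁻¹ • (t : G ⧸ K)) ≠ t := by
        intro h
        refine hq ?_
        have h' : (((q.out : G)⁻¹ * t : G) : G ⧸ K) = t := h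
        have h2 := hmal t ht htK q.out q.out.2 (by simpa [mul_assoc] using QuotientGroup.eq.1 h')
        rw [← QuotientGroup.out_eq' q, eq_comm]
        refine QuotientGroup.eq.2 ?_
        simpa [Subgroup.mem_subgroupOf] using h2
      have hq2 : (t : G ⧸ K) = (q.out : G) • (q.out : G)⁻¹ • (t : G ⧸ K) :=
        (smul_inv_smul _ _).symm
      conv_lhs => enter [1, 1]; rw [hq2]
      rw [← smul_projection he hπ, projection_projection he hπ, if_neg hq'.symm, smul_zero]
    · simp
  have hVY' : translateSpan k e (K : Set G) ≤ Y' := by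
    refine translateSpan_le fun g hg ↦ ?_
    have hgV := hV g hg e heK
    have h0 : ζ (g • e) = 0 := by
      refine hinj _ hcT _ (hζ _ hgV).1 ?_
      rw [← hf _ hgV, ← hf_smul ⟨g, hg⟩ e heK, hfe, smul_zero, map_zero]
    simpa [h0] using (hζ _ hgV).2
  have hwY : π ((1 : G) : G ⧸ K) w ∈ translateSpan k e (K : Set G) := by
    refine translateSpan_mono (fun g hg ↦ ?_) (projection_mem he hπ _ w)
    simpa using QuotientGroup.eq.1 (Set.mem_singleton_iff.1 hg).symm
  exact absurd (hinj _ h1T w ⟨hwX, hwT⟩ ((Submodule.disjoint_def.1 hdisj) _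
    ⟨w, ⟨hwX, hwT⟩, rfl⟩ (hVY' hwY))) hw0

lemma IsInducedFrom.irreducibleOn_comap_of_prime_or_zero (he : IsInducedFrom H χ e)
    (hschur : ∀ m : M, (∀ h : H, (h : G) • m = (χ h : k) • m) → ∃ a : k, m = a • e)
    {Q : Type*} [Group Q] (f : G →* Q) {L : Subgroup Q} (hHL : H ≤ L.comap f) {c : Q}
    (hc : ∀ x : Q, ∃ j : ℤ, x * c * x⁻¹ = c ^ j) (p : ℕ) (hp : p.Prime ∨ p = 0)
    (hpL : ∀ j : ℤ, c ^ j ∈ L ↔ (p : ℤ) ∣ j) (hL : IrreducibleOn k e (L.comap f)) :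
    IrreducibleOn k e ((L ⊔ Subgroup.zpowers c).comap f) := by
  obtain ⟨L₀, hle, hnorm, hfin, hmal⟩ := exists_malnormal_kernel L c hc p hp hpL
  refine he.irreducibleOn_of_malnormal hschur (K₀ := L₀.comap f) hHL
    (Subgroup.comap_mono le_sup_left) (Subgroup.comap_mono hle) (fun t ht x hx ↦ ?_)
    (Subgroup.relIndex_comap_ne_zero f hfin) (fun t ht htL x hx htx ↦ ?_) hL
  · simpa using hnorm (f t) ht (f x) hx
  · exact hmal (f t) ht htL (f x) hx (by simpa using htx)

lemma IsInducedFrom.irreducibleOn_comap_of_pow_mem (he : IsInducedFrom H χ e)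
    (hschur : ∀ m : M, (∀ h : H, (h : G) • m = (χ h : k) • m) → ∃ a : k, m = a • e)
    {Q : Type*} [Group Q] (f : G →* Q) {c : Q} (hc : ∀ x : Q, ∃ j : ℤ, x * c * x⁻¹ = c ^ j)
    {n : ℕ} (hn : n ≠ 0) {L : Subgroup Q} (hHL : H ≤ L.comap f) (hnL : c ^ n ∈ L)
    (hL : IrreducibleOn k e (L.comap f)) :
    IrreducibleOn k e ((L ⊔ Subgroup.zpowers c).comap f) := by
  induction n using Nat.strong_induction_on generalizing L with
  | _ n ih =>
    by_cases hn1 : n = 1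
    · rw [hn1, pow_one] at hnL
      rwa [sup_eq_left.2 ((Subgroup.zpowers_le).2 hnL)]
    obtain ⟨p, hp, m, rfl⟩ := Nat.exists_prime_and_dvd hn1
    have hm : m ≠ 0 := by rintro rfl; simp at hn
    have hlt : m < p * m := lt_mul_of_one_lt_left (Nat.pos_of_ne_zero hm) hp.one_lt
    by_cases hmL : c ^ m ∈ L
    · exact ih m hlt hm hHL hmL hL
    have hpL : ∀ j : ℤ, (c ^ m) ^ j ∈ L ↔ (p : ℤ) ∣ j := by
      have hpm : (c ^ m) ^ (p : ℤ) ∈ L := by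
        rwa [zpow_natCast, ← pow_mul, mul_comm]
      refine fun j ↦ ⟨fun hj ↦ ?_, ?_⟩
      · by_contra hpj
        obtain ⟨u, v, huv⟩ := (Prime.coprime_iff_not_dvd (Nat.prime_iff_prime_int.1 hp)).2 hpj
        refine hmL ?_
        rw [← zpow_one (c ^ m), ← huv, zpow_add, mul_comm u, mul_comm v, zpow_mul, zpow_mul]
        exact mul_mem (zpow_mem hpm u) (zpow_mem hj v)
      · rintro ⟨i, rfl⟩
        rw [zpow_mul]
        exact zpow_mem hpm i
    have hcm (x : Q) : ∃ j : ℤ, x * c ^ m * x⁻¹ = (c ^ m) ^ j := by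
      obtain ⟨j, hj⟩ := hc x
      exact ⟨j, by rw [← conj_pow, hj, ← zpow_natCast, ← zpow_natCast, zpow_comm]⟩
    have h := ih m hlt hm (hHL.trans (Subgroup.comap_mono le_sup_left))
      (Subgroup.mem_sup_right (Subgroup.mem_zpowers _))
      (he.irreducibleOn_comap_of_prime_or_zero hschur f hHL hcm p (Or.inl hp) hpL hL)
    rwa [sup_assoc, sup_eq_right.2 (Subgroup.zpowers_le.2
      (pow_mem (Subgroup.mem_zpowers c) m) : Subgroup.zpowers (c ^ m) ≤ _)] at h

lemma IsInducedFrom.irreducibleOn_comap_sup_zpowers (he : IsInducedFrom H χ e)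
    (hschur : ∀ m : M, (∀ h : H, (h : G) • m = (χ h : k) • m) → ∃ a : k, m = a • e)
    {Q : Type*} [Group Q] (f : G →* Q) {c : Q} (hc : ∀ x : Q, ∃ j : ℤ, x * c * x⁻¹ = c ^ j)
    {L : Subgroup Q} (hHL : H ≤ L.comap f) (hL : IrreducibleOn k e (L.comap f)) :
    IrreducibleOn k e ((L ⊔ Subgroup.zpowers c).comap f) := by
  by_cases hn : ∃ n : ℕ, n ≠ 0 ∧ c ^ n ∈ L
  · obtain ⟨n, hn, hnL⟩ := hn
    exact he.irreducibleOn_comap_of_pow_mem hschur f hc hn hHL hnL hL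
  · push Not at hn
    refine he.irreducibleOn_comap_of_prime_or_zero hschur f hHL hc 0 (Or.inr rfl)
      (fun j ↦ ⟨fun hj ↦ ?_, ?_⟩) hL
    · by_contra h
      rw [Nat.cast_zero, zero_dvd_iff] at h
      refine hn j.natAbs (Int.natAbs_ne_zero.2 h) ?_
      rcases Int.natAbs_eq j with h | h <;> rw [h] at hj
      · rwa [zpow_natCast] at hj
      · rwa [zpow_neg, zpow_natCast, inv_mem_iff] at hj
    · simp +contextual [zero_dvd_iff]

/-- Irreducibility passes from `H ⊔ N` to `H ⊔ N'` when `N ≤ N'` are normal with cyclic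
quotient. -/
lemma IsInducedFrom.irreducibleOn_sup (he : IsInducedFrom H χ e)
    (hschur : ∀ m : M, (∀ h : H, (h : G) • m = (χ h : k) • m) → ∃ a : k, m = a • e)
    {N N' : Subgroup G} [N.Normal] [N'.Normal] {a : G} (ha : N' = N ⊔ Subgroup.closure {a})
    (hN : IrreducibleOn k e (H ⊔ N)) : IrreducibleOn k e (H ⊔ N') := by
  have hmap : N'.map (QuotientGroup.mk' N) = Subgroup.zpowers (QuotientGroup.mk' N a) := by
    rw [ha, Subgroup.map_sup, ← Subgroup.zpowers_eq_closure, MonoidHom.map_zpowers,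
      QuotientGroup.map_mk'_self, bot_sup_eq]
  have hc (x : G ⧸ N) : ∃ j : ℤ,
      x * QuotientGroup.mk' N a * x⁻¹ = QuotientGroup.mk' N a ^ j := by
    obtain ⟨g, rfl⟩ := QuotientGroup.mk'_surjective N x
    have haN' : a ∈ N' := ha ▸ Subgroup.mem_sup_right (Subgroup.subset_closure rfl)
    have h := Subgroup.mem_map_of_mem (QuotientGroup.mk' N)
      (Subgroup.Normal.conj_mem inferInstance a haN' g)
    rw [hmap] at h
    obtain ⟨j, hj⟩ := h
    exact ⟨j, by simpa using hj.symm⟩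
  have hcomap (K : Subgroup G) (hK : N ≤ K) :
      (K.map (QuotientGroup.mk' N)).comap (QuotientGroup.mk' N) = K :=
    Subgroup.comap_map_eq_self (by rwa [QuotientGroup.ker_mk'])
  have h := he.irreducibleOn_comap_sup_zpowers hschur (QuotientGroup.mk' N) hc
    (L := (H ⊔ N).map (QuotientGroup.mk' N))
    (by rw [hcomap _ le_sup_right]; exact le_sup_left) (by rwa [hcomap _ le_sup_right])
  have hNN' : N ≤ N' := ha ▸ le_sup_left
  rwa [← hmap, ← Subgroup.map_sup, sup_assoc, sup_eq_right.2 hNN',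
    hcomap _ (hNN'.trans le_sup_right)] at h

omit [SMulCommClass G k M] in
lemma IsInducedFrom.irreducibleOn_self (he : IsInducedFrom H χ e) : IrreducibleOn k e H := by
  intro X hX _ hX0
  obtain ⟨x, hx, hx0⟩ := Submodule.exists_mem_ne_zero_of_ne_bot hX0
  have hle : translateSpan k e (H : Set G) ≤ Submodule.span k {e} := by
    refine translateSpan_le fun g hg ↦ ?_
    rw [he.smul_eq ⟨g, hg⟩]
    exact Submodule.smul_mem _ _ (Submodule.mem_span_singleton_self e)
  obtain ⟨a, rfl⟩ := Submodule.mem_span_singleton.1 (hle (hX hx))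
  exact (Submodule.smul_mem_iff _ (left_ne_zero_of_smul hx0)).1 hx

/-- Schur irreducibility of a representation induced from a character of a subgroup of a
supersolvable group implies its irreducibility. -/
lemma IsInducedFrom.irreducibleOn_top (he : IsInducedFrom H χ e)
    (hschur : ∀ m : M, (∀ h : H, (h : G) • m = (χ h : k) • m) → ∃ a : k, m = a • e)
    (hG : IsSupersolvable G) : IrreducibleOn k e (⊤ : Subgroup G) := by
  obtain ⟨n, N, h0, hlast, -, hnormal, hcyclic⟩ := hG
  have h (i : ℕ) (hi : i ≤ n + 1) : IrreducibleOn k e (H ⊔ N i) := by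
    induction hi using Nat.decreasingInduction with
    | self => simpa [hlast] using he.irreducibleOn_self
    | of_succ i hi ih =>
      obtain ⟨a, ha⟩ := hcyclic i (Nat.lt_succ_iff.1 hi)
      have := hnormal i
      have := hnormal (i + 1)
      exact he.irreducibleOn_sup hschur ha ih
  simpa [h0] using h 0 (Nat.zero_le _)

end Stable

namespace IndChar

variable {G : Type*} [Group G] {H : Subgroup G} {χ : H →* ℂˣ}

noncomputable instance : DistribMulAction G (IndChar H χ) :=
  DistribMulAction.compHom _ (MonoidAlgebra.of ℂ G)

lemma smul_def (g : G) (m : IndChar H χ) : g • m = MonoidAlgebra.single g (1 : ℂ) • m := rfl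

instance : SMulCommClass G ℂ (IndChar H χ) where
  smul_comm g c m := by simp only [smul_def]; exact smul_comm _ _ _

variable (H χ) in
/-- The canonical generator of the induced module. -/
noncomputable def gen : IndChar H χ := Submodule.Quotient.mk 1

lemma mk_eq_smul_gen (x : MonoidAlgebra ℂ G) :
    (Submodule.Quotient.mk x : IndChar H χ) = x • gen H χ := by
  rw [gen, ← Submodule.Quotient.mk_smul, smul_eq_mul, mul_one]

lemma coe_smul_gen (h : H) : (h : G) • gen H χ = (χ h : ℂ) • gen H χ := by
  rw [smul_def, ← mk_eq_smul_gen, gen, ← Submodule.Quotient.mk_smul, Submodule.Quotient.eq]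
  exact Submodule.subset_span ⟨h, rfl⟩

lemma eq_top_of_gen_mem {X : Submodule (MonoidAlgebra ℂ G) (IndChar H χ)} (hX : gen H χ ∈ X) :
    X = ⊤ := by
  refine eq_top_iff.2 fun m _ ↦ ?_
  induction m using Submodule.Quotient.induction_on with
  | _ x => rw [mk_eq_smul_gen]; exact X.smul_mem x hX

/-- Functions on `G` that transform by `χ` under right translation by `H` extend to linear maps
on the induced module. -/
lemma exists_linearMap {N : Type*} [AddCommGroup N] [Module ℂ N] (f : G → N)
    (hf : ∀ (g : G) (h : H), f (g * h) = (χ h : ℂ) • f g) :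
    ∃ π : IndChar H χ →ₗ[ℂ] N, ∀ g : G, π (g • gen H χ) = f g := by
  let F : MonoidAlgebra ℂ G →ₗ[ℂ] N := (MonoidAlgebra.basis G ℂ).constr ℂ f
  have hF (g : G) : F (MonoidAlgebra.single g 1) = f g := by
    rw [← MonoidAlgebra.basis_apply]; exact (MonoidAlgebra.basis G ℂ).constr_basis ℂ f g
  let S := Submodule.span (MonoidAlgebra ℂ G) {x : MonoidAlgebra ℂ G | ∃ h : H,
      x = MonoidAlgebra.single (h : G) (1 : ℂ) - (χ h : ℂ) • (1 : MonoidAlgebra ℂ G)}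
  have hS : S.restrictScalars ℂ ≤ LinearMap.ker F := by
    intro x hx
    refine Submodule.span_induction (p := fun x _ ↦ ∀ y : MonoidAlgebra ℂ G, F (y * x) = 0)
      ?_ ?_ ?_ ?_ (show x ∈ S from hx) 1 |> fun h ↦ by simpa using h
    · rintro _ ⟨h, rfl⟩ y
      induction y using MonoidAlgebra.induction_linear with
      | zero => simp
      | add y z hy hz => rw [add_mul, map_add, hy, hz, add_zero]
      | single g r =>
        have : MonoidAlgebra.single g r = r • MonoidAlgebra.single g (1 : ℂ) := by simp
        rw [this, smul_mul_assoc, map_smul, mul_sub, MonoidAlgebra.single_mul_single,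
          mul_smul_comm, mul_one, mul_one, map_sub, map_smul, hF, hF, hf, sub_self, smul_zero]
    · simp
    · intro a b _ _ ha hb y
      rw [mul_add, map_add, ha, hb, add_zero]
    · intro a b _ hb y
      rw [smul_eq_mul, ← mul_assoc, hb]
  refine ⟨(Submodule.liftQ _ F hS) ∘ₗ
    (Submodule.Quotient.restrictScalarsEquiv ℂ S).symm.toLinearMap, fun g ↦ ?_⟩
  rw [smul_def, ← mk_eq_smul_gen]
  exact hF g

lemma isInducedFrom_gen : IsInducedFrom H χ (gen H χ) where
  ne_zero h := by
    classical
    obtain ⟨π, hπ⟩ := exists_linearMap (χ := χ)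
      (fun g ↦ if hg : g ∈ H then ((χ ⟨g, hg⟩ : ℂˣ) : ℂ) else 0) (fun g h ↦ by
        have hgh : g * h ∈ H ↔ g ∈ H := H.mul_mem_cancel_right h.2
        by_cases hg : g ∈ H
        · rw [dif_pos hg, dif_pos (hgh.2 hg), smul_eq_mul, mul_comm, ← Units.val_mul, ← map_mul]
          rfl
        · rw [dif_neg hg, dif_neg (mt hgh.1 hg), smul_zero])
    have h1 := hπ 1
    rw [h, smul_zero, map_zero, dif_pos H.one_mem] at h1
    exact (χ ⟨1, H.one_mem⟩).ne_zero h1.symm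
  smul_eq := coe_smul_gen
  span_eq_top := by
    refine eq_top_iff.2 fun m _ ↦ ?_
    induction m using Submodule.Quotient.induction_on with
    | _ x =>
      rw [mk_eq_smul_gen]
      induction x using MonoidAlgebra.induction_linear with
      | zero => rw [zero_smul]; exact zero_mem _
      | add y z hy hz => rw [add_smul]; exact add_mem (hy trivial) (hz trivial)
      | single g r =>
        have : MonoidAlgebra.single g r = r • MonoidAlgebra.single g (1 : ℂ) := by simp
        rw [this, smul_assoc, ← smul_def]
        exact Submodule.smul_mem _ _ (Submodule.subset_span ⟨g, trivial, rfl⟩)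
  exists_restriction S hS := by
    classical
    obtain ⟨π, hπ⟩ := exists_linearMap (χ := χ)
      (fun g ↦ if g ∈ S then g • gen H χ else 0) (fun g h ↦ by
        simp only [hS g h h.2]
        split_ifs
        · rw [mul_smul, coe_smul_gen, smul_comm]
        · rw [smul_zero])
    exact ⟨π, fun g ↦ ⟨fun hg ↦ by rw [hπ, if_pos hg], fun hg ↦ by rw [hπ, if_neg hg]⟩⟩

/-- Frobenius reciprocity: a vector on which `H` acts by `χ` is the image of the generator under
an endomorphism of the induced module. -/
lemma exists_endomorphism (m : IndChar H χ) (hm : ∀ h : H, (h : G) • m = (χ h : ℂ) • m) :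
    ∃ f : IndChar H χ →ₗ[MonoidAlgebra ℂ G] IndChar H χ, f (gen H χ) = m := by
  refine ⟨Submodule.liftQ _ (LinearMap.toSpanSingleton (MonoidAlgebra ℂ G) _ m) ?_, ?_⟩
  · rw [Submodule.span_le]
    rintro _ ⟨h, rfl⟩
    rw [SetLike.mem_coe, LinearMap.mem_ker, LinearMap.toSpanSingleton_apply, sub_smul, ← smul_def,
      hm, smul_assoc, one_smul, sub_self]
  · exact LinearMap.toSpanSingleton_apply_one (MonoidAlgebra ℂ G) _ m

end IndChar

/-- For a supersolvable group `G`, if `Ind_H^G χ` is Schur irreducible then it is a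
simple `ℂ[G]`-module. -/
theorem isSimpleModule_indChar_of_schurIrreducible (G : Type*) [Group G]
    (hG : IsSupersolvable G) (H : Subgroup G) (χ : H →* ℂˣ)
    (hschur : SchurIrreducible G (IndChar H χ)) :
    IsSimpleModule (MonoidAlgebra ℂ G) (IndChar H χ) := by
  have hirr : IrreducibleOn ℂ (IndChar.gen H χ) (⊤ : Subgroup G) :=
    IndChar.isInducedFrom_gen.irreducibleOn_top (fun m hm ↦ by
      obtain ⟨f, rfl⟩ := IndChar.exists_endomorphism m hm
      obtain ⟨c, hc⟩ := hschur f
      exact ⟨c, hc _⟩) hG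
  have : Nontrivial (IndChar H χ) := ⟨_, _, IndChar.isInducedFrom_gen.ne_zero⟩
  have : IsSimpleOrder (Submodule (MonoidAlgebra ℂ G) (IndChar H χ)) := by
    refine ⟨fun X ↦ or_iff_not_imp_left.2 fun hX ↦ IndChar.eq_top_of_gen_mem ?_⟩
    refine hirr (X.restrictScalars ℂ) ?_ (fun g _ x hx ↦ X.smul_mem _ hx) ?_
    · rw [Subgroup.coe_top, IndChar.isInducedFrom_gen.span_eq_top]
      exact le_top
    · rwa [Ne, Submodule.restrictScalars_eq_bot_iff]
  exact ⟨⟩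
end

section
/- Every irreducible ℂ-representation of the infinite dihedral group D∞ is monomial; that is, every simple ℂ[D∞]-module is isomorphic as a ℂ[D∞]-module to Ind_H^{D∞}(χ) for some subgroup H ≤ D∞ and character χ : H →* ℂˣ. -/
open scoped TensorProduct

/-- A `ℂ[G]`-module is monomial if it is isomorphic, as a `ℂ[G]`-module, to a
representation induced from a character of some subgroup. -/
def IsMonomial (G : Type*) [Group G] (V : Type*) [AddCommGroup V]
    [Module (MonoidAlgebra ℂ G) V] : Prop :=
  ∃ (H : Subgroup G) (χ : H →* ℂˣ),
    Nonempty (V ≃ₗ[MonoidAlgebra ℂ G] IndChar H χ)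

open MonoidAlgebra Polynomial

section Monomial

variable {G : Type*} [Group G] {V : Type*} [AddCommGroup V] [Module (MonoidAlgebra ℂ G) V]

theorem single_smul_single_smul (g h : G) (v : V) :
    (single g 1 : MonoidAlgebra ℂ G) • (single h 1 : MonoidAlgebra ℂ G) • v =
      (single (g * h) 1 : MonoidAlgebra ℂ G) • v := by
  rw [smul_smul, single_mul_single, one_mul]

theorem single_one_smul (v : V) : (single 1 1 : MonoidAlgebra ℂ G) • v = v := by
  rw [← one_def, one_smul]

variable [Module ℂ V] [IsScalarTower ℂ (MonoidAlgebra ℂ G) V]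

/-- The action of a group element commutes with complex scalars. -/
theorem single_smul_comm (g : G) (c : ℂ) (v : V) :
    (single g 1 : MonoidAlgebra ℂ G) • c • v = c • (single g 1 : MonoidAlgebra ℂ G) • v := by
  rw [← algebraMap_smul (MonoidAlgebra ℂ G) c v, smul_smul, ← Algebra.commutes,
    ← Algebra.smul_def, smul_assoc]

/-- A subgroup preserving a line acts on it through a character. -/
theorem exists_character_of_forall_exists_smul (H : Subgroup G) {v : V} (hv : v ≠ 0)
    (h : ∀ g : H, ∃ c : ℂ, (single (g : G) 1 : MonoidAlgebra ℂ G) • v = c • v) :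
    ∃ χ : H →* ℂˣ, ∀ g : H, (single (g : G) 1 : MonoidAlgebra ℂ G) • v = (χ g : ℂ) • v := by
  choose c hc using h
  have inj := smul_left_injective ℂ hv
  refine ⟨MonoidHom.toHomUnits
    { toFun := c, map_one' := inj ?_, map_mul' := fun x y => inj ?_ }, hc⟩
  · simp only [← hc, OneMemClass.coe_one, single_one_smul, one_smul]
  · simp only [← hc, Subgroup.coe_mul]
    rw [← single_smul_single_smul, hc, single_smul_comm, hc, smul_smul, mul_comm]

/-- A simple module is induced from a character of `H` as soon as it contains a vector spanning an
`H`-stable line whose translates under a left transversal of `H` are linearly independent. -/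
theorem isMonomial_of_linearIndependent_transversal
    [IsSimpleModule (MonoidAlgebra ℂ G) V] (H : Subgroup G) {v : V} (hv : v ≠ 0)
    (hH : ∀ g : H, ∃ c : ℂ, (single (g : G) 1 : MonoidAlgebra ℂ G) • v = c • v)
    {ι : Type*} [Fintype ι] (t : ι → G) (ht : ∀ g, ∃ i, (t i)⁻¹ * g ∈ H)
    (hli : LinearIndependent ℂ fun i => (single (t i) 1 : MonoidAlgebra ℂ G) • v) :
    IsMonomial G V := by
  classical
  obtain ⟨χ, hχ⟩ := exists_character_of_forall_exists_smul H hv hH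
  refine ⟨H, χ, ⟨LinearEquiv.symm ?_⟩⟩
  set I := Submodule.span (MonoidAlgebra ℂ G)
    {x : MonoidAlgebra ℂ G | ∃ h : H,
      x = MonoidAlgebra.single (h : G) (1 : ℂ) - (χ h : ℂ) • (1 : MonoidAlgebra ℂ G)} with hI
  set f := LinearMap.toSpanSingleton (MonoidAlgebra ℂ G) V v with hf
  have hIf : I ≤ LinearMap.ker f := by
    rw [hI, Submodule.span_le]
    rintro _ ⟨h, rfl⟩
    simp [hf, sub_smul, hχ]
  have hrep (a : MonoidAlgebra ℂ G) :
      ∃ c : ι → ℂ, a - ∑ i, c i • (single (t i) 1 : MonoidAlgebra ℂ G) ∈ I := by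
    induction a using MonoidAlgebra.induction_on with
    | of g =>
      obtain ⟨i, hi⟩ := ht g
      refine ⟨Pi.single i (χ ⟨_, hi⟩ : ℂ), ?_⟩
      have := I.smul_mem (single (t i) 1 : MonoidAlgebra ℂ G)
        (Submodule.subset_span ⟨⟨_, hi⟩, rfl⟩)
      simpa [mul_sub, Pi.single_apply, ite_smul] using this
    | add x y hx hy =>
      obtain ⟨c, hc⟩ := hx
      obtain ⟨d, hd⟩ := hy
      refine ⟨c + d, ?_⟩
      simpa [add_smul, Finset.sum_add_distrib, add_sub_add_comm] using I.add_mem hc hd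
    | smul z x hx =>
      obtain ⟨c, hc⟩ := hx
      refine ⟨z • c, ?_⟩
      have := I.smul_mem (algebraMap ℂ (MonoidAlgebra ℂ G) z) hc
      rwa [algebraMap_smul, smul_sub, Finset.smul_sum, Finset.sum_congr rfl fun i _ =>
        smul_smul z (c i) _] at this
  have hker : LinearMap.ker f ≤ I := by
    intro a ha
    obtain ⟨c, hc⟩ := hrep a
    have h0 := hIf hc
    have hsum : ∑ i, c i • (single (t i) 1 : MonoidAlgebra ℂ G) • v = 0 := by
      have := (LinearMap.ker f).sub_mem ha h0
      simpa only [sub_sub_cancel, LinearMap.mem_ker, hf, LinearMap.toSpanSingleton_apply,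
        Finset.sum_smul, smul_assoc] using this
    have hc0 := Fintype.linearIndependent_iff.mp hli c hsum
    simpa [hc0] using hc
  refine LinearEquiv.ofBijective (I.liftQ f hIf) ⟨?_, ?_⟩
  · rw [← LinearMap.ker_eq_bot, Submodule.ker_liftQ_eq_bot _ _ _ hker]
  · rw [← LinearMap.range_eq_top, Submodule.range_liftQ, LinearMap.range_eq_top]
    exact IsSimpleModule.toSpanSingleton_surjective _ hv

end Monomial

/-- An endomorphism `f` of a simple module is a scalar as soon as the module is finitely generated
over the polynomial ring acting through `f`, that is, some finite set lies in no proper `f`-stable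
subspace. -/
theorem exists_eq_smul_of_finite_aeval {A V : Type*} [Ring A] [Algebra ℂ A] [AddCommGroup V]
    [Module ℂ V] [Module A V] [IsScalarTower ℂ A V] [IsSimpleModule A V]
    (f : Module.End A V) (s : Finset V)
    (hs : ∀ N : Submodule ℂ V, (∀ x ∈ s, x ∈ N) → (∀ x ∈ N, f x ∈ N) → N = ⊤) :
    ∃ c : ℂ, ∀ v, f v = c • v := by
  classical
  have : Nontrivial V := IsSimpleModule.nontrivial A V
  by_cases hf : f = 0
  · exact ⟨0, fun v => by simp [hf]⟩
  have hsurj : Function.Surjective f := ((LinearMap.bijective_or_eq_zero f).resolve_right hf).2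
  let φ : ℂ[X] →ₐ[ℂ] Module.End A V := aeval f
  let _ : Module ℂ[X] V := Module.compHom V φ.toRingHom
  have smul_def (p : ℂ[X]) (v : V) : p • v = φ p v := rfl
  have X_smul (v : V) : (X : ℂ[X]) • v = f v := by simp [smul_def, φ]
  have C_smul (c : ℂ) (v : V) : (C c : ℂ[X]) • v = c • v := by
    simp [smul_def, φ, Module.algebraMap_end_apply]
  have hfg : (⊤ : Submodule ℂ[X] V).FG := by
    refine ⟨s, ?_⟩
    let N : Submodule ℂ V :=
      { (Submodule.span ℂ[X] (s : Set V)).toAddSubmonoid with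
        smul_mem' := fun c x hx => by
          rw [← C_smul]
          exact (Submodule.span ℂ[X] (s : Set V)).smul_mem _ hx }
    have hN : N = ⊤ := hs N (fun x hx => Submodule.subset_span hx) fun x hx => by
      rw [← X_smul]
      exact (Submodule.span ℂ[X] (s : Set V)).smul_mem _ hx
    exact eq_top_iff.mpr fun x _ => (hN ▸ Submodule.mem_top : x ∈ N)
  obtain ⟨p, hp, hp0⟩ := Submodule.exists_sub_one_mem_and_smul_eq_zero_of_fg_of_le_smul
    (Ideal.span {(X : ℂ[X])}) ⊤ hfg fun x _ => by
      obtain ⟨y, rfl⟩ := hsurj x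
      rw [← X_smul]
      exact Submodule.smul_mem_smul (Ideal.mem_span_singleton_self _) Submodule.mem_top
  have hpne : p ≠ 0 := by
    rintro rfl
    rw [Ideal.mem_span_singleton, X_dvd_iff] at hp
    simp at hp
  have hpf : aeval f p = 0 := LinearMap.ext fun v => hp0 v Submodule.mem_top
  have hprod : aeval f (p.roots.map fun x => X - C x).prod = 0 := by
    have hsplit := (IsAlgClosed.splits p).eq_prod_roots
    rw [hsplit, map_mul, aeval_C, ← Algebra.smul_def] at hpf
    exact (smul_eq_zero.mp hpf).resolve_left (leadingCoeff_ne_zero.mpr hpne)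
  obtain ⟨c, hc, -⟩ := spectrum.exists_mem_of_not_isUnit_aeval_prod (p := p) (a := f)
    (by rw [hprod]; exact not_isUnit_zero)
  refine ⟨c, fun v => ?_⟩
  have h0 : algebraMap ℂ (Module.End A V) c - f = 0 := by
    by_contra h
    exact hc (isUnit_iff_ne_zero.mpr h)
  have := LinearMap.congr_fun (sub_eq_zero.mp h0) v
  rwa [Module.algebraMap_end_apply, eq_comm] at this

namespace DihedralGroup

variable {V : Type*} [AddCommGroup V] [Module (MonoidAlgebra ℂ (DihedralGroup 0)) V]

/-- The element `r + r⁻¹` of the group algebra. -/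
noncomputable def trace : MonoidAlgebra ℂ (DihedralGroup 0) :=
  single (r 1) 1 + single (r (-1)) 1

theorem trace_commute (a : MonoidAlgebra ℂ (DihedralGroup 0)) : Commute trace a := by
  induction a using MonoidAlgebra.induction_on with
  | of g =>
    cases g with
    | r i => simp [trace, commute_iff_eq, add_mul, mul_add, single_mul_single, add_comm]
    | sr i =>
      simp only [trace, commute_iff_eq, add_mul, mul_add, of_apply, single_mul_single, r_mul_sr,
        sr_mul_r, sub_neg_eq_add, ← sub_eq_add_neg]
      exact add_comm _ _
  | add x y hx hy => exact hx.add_right hy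
  | smul c x hx => exact hx.smul_right c

theorem trace_smul (v : V) :
    trace • v = (single (r 1) 1 : MonoidAlgebra ℂ (DihedralGroup 0)) • v +
      (single (r (-1)) 1 : MonoidAlgebra ℂ (DihedralGroup 0)) • v :=
  add_smul _ _ _

theorem trace_smul_single_r_smul (i : ZMod 0) (v : V) :
    trace • (single (r i) 1 : MonoidAlgebra ℂ (DihedralGroup 0)) • v =
      (single (r (i + 1)) 1 : MonoidAlgebra ℂ (DihedralGroup 0)) • v +
      (single (r (i - 1)) 1 : MonoidAlgebra ℂ (DihedralGroup 0)) • v := by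
  rw [trace_smul, single_smul_single_smul, single_smul_single_smul, r_mul_r, r_mul_r,
    add_comm 1 i, neg_add_eq_sub]

variable [Module ℂ V]

/-- A subspace stable under `r + r⁻¹` contains the `⟨r⟩`-orbit of `v` once it contains `v`
and `r v`. -/
theorem single_r_smul_mem {N : Submodule ℂ V} (hN : ∀ x ∈ N, trace • x ∈ N) {v : V} (hv : v ∈ N)
    (hrv : (single (r 1) 1 : MonoidAlgebra ℂ (DihedralGroup 0)) • v ∈ N) (i : ZMod 0) :
    (single (r i) 1 : MonoidAlgebra ℂ (DihedralGroup 0)) • v ∈ N := by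
  obtain ⟨i, rfl⟩ := ZMod.intCast_surjective i
  suffices h : (single (r (Int.cast i)) 1 : MonoidAlgebra ℂ (DihedralGroup 0)) • v ∈ N ∧
      (single (r (Int.cast i + 1)) 1 : MonoidAlgebra ℂ (DihedralGroup 0)) • v ∈ N from h.1
  induction i using Int.induction_on with
  | zero =>
    rw [Int.cast_zero, zero_add, r_zero, single_one_smul]
    exact ⟨hv, hrv⟩
  | succ i ih =>
    rw [Int.cast_add, Int.cast_one]
    refine ⟨ih.2, ?_⟩
    have h := N.sub_mem (hN _ ih.2) ih.1
    rwa [trace_smul_single_r_smul, add_sub_cancel_right, add_sub_cancel_right] at h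
  | pred i ih =>
    rw [Int.cast_sub, Int.cast_one, sub_add_cancel]
    refine ⟨?_, ih.1⟩
    have h := N.sub_mem (hN _ ih.1) ih.2
    rwa [trace_smul_single_r_smul, add_sub_cancel_left] at h

variable [IsScalarTower ℂ (MonoidAlgebra ℂ (DihedralGroup 0)) V]
  [IsSimpleModule (MonoidAlgebra ℂ (DihedralGroup 0)) V]

variable (V) in
/-- The central element `r + r⁻¹` acts on a simple module by a scalar. -/
theorem exists_trace_smul_eq : ∃ c : ℂ, ∀ v : V, trace • v = c • v := by
  classical
  have : Nontrivial V := IsSimpleModule.nontrivial (MonoidAlgebra ℂ (DihedralGroup 0)) V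
  obtain ⟨v, hv⟩ := exists_ne (0 : V)
  let f : Module.End (MonoidAlgebra ℂ (DihedralGroup 0)) V :=
    { toFun := fun x => trace • x
      map_add' := smul_add _
      map_smul' := fun a x => by
        rw [smul_smul, (trace_commute a).eq, ← smul_smul, RingHom.id_apply] }
  let w := (single (sr 0) 1 : MonoidAlgebra ℂ (DihedralGroup 0)) • v
  refine exists_eq_smul_of_finite_aeval f
    {v, (single (r 1) 1 : MonoidAlgebra ℂ (DihedralGroup 0)) • v,
      w, (single (r 1) 1 : MonoidAlgebra ℂ (DihedralGroup 0)) • w} fun N hs hN => ?_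
  simp only [Finset.mem_insert, Finset.mem_singleton, forall_eq_or_imp, forall_eq] at hs
  obtain ⟨h1, h2, h3, h4⟩ := hs
  refine eq_top_iff.mpr fun x _ => ?_
  obtain ⟨a, rfl⟩ := IsSimpleModule.toSpanSingleton_surjective
    (MonoidAlgebra ℂ (DihedralGroup 0)) hv x
  rw [LinearMap.toSpanSingleton_apply]
  induction a using MonoidAlgebra.induction_on with
  | of g =>
    cases g with
    | r i => exact single_r_smul_mem hN h1 h2 i
    | sr i =>
      have h := single_r_smul_mem hN h3 h4 (-i)
      rwa [single_smul_single_smul, r_mul_sr, zero_sub, neg_neg] at h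
  | add x y hx hy => rw [add_smul]; exact N.add_mem (hx trivial) (hy trivial)
  | smul c x hx => rw [smul_assoc]; exact N.smul_mem c (hx trivial)

variable (V) in
/-- The rotation `r` has an eigenvector in every simple module. -/
theorem exists_eigenvector_r : ∃ v : V, v ≠ 0 ∧
    ∃ a : ℂ, (single (r 1) 1 : MonoidAlgebra ℂ (DihedralGroup 0)) • v = a • v := by
  have : Nontrivial V := IsSimpleModule.nontrivial (MonoidAlgebra ℂ (DihedralGroup 0)) V
  obtain ⟨c, hc⟩ := exists_trace_smul_eq V
  obtain ⟨a, ha⟩ := exists_quadratic_eq_zero (a := (1 : ℂ)) (b := -c) (c := 1) one_ne_zero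
    (IsAlgClosed.exists_eq_mul_self _)
  obtain ⟨v, hv⟩ := exists_ne (0 : V)
  by_cases h : (single (r 1) 1 : MonoidAlgebra ℂ (DihedralGroup 0)) • v = a • v
  · exact ⟨v, hv, a, h⟩
  refine ⟨_, sub_ne_zero.mpr h, c - a, ?_⟩
  have h2 := hc ((single (r 1) 1 : MonoidAlgebra ℂ (DihedralGroup 0)) • v)
  rw [trace_smul, single_smul_single_smul (r (-1)), r_mul_r, neg_add_cancel, r_zero,
    single_one_smul] at h2
  rw [smul_sub, single_smul_comm, eq_sub_of_add_eq h2]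
  have hav : (c * a - a * a - 1) • v = 0 := by
    rw [show c * a - a * a - 1 = 0 by linear_combination -ha, zero_smul]
  generalize (single (r 1) 1 : MonoidAlgebra ℂ (DihedralGroup 0)) • v = w
  linear_combination (norm := module) hav

/-- An eigenvector of `r` in a simple module spans a line stable under all rotations. -/
theorem exists_single_r_smul_eq {v : V} {a : ℂ}
    (ha : (single (r 1) 1 : MonoidAlgebra ℂ (DihedralGroup 0)) • v = a • v) (i : ZMod 0) :
    ∃ c : ℂ, (single (r i) 1 : MonoidAlgebra ℂ (DihedralGroup 0)) • v = c • v := by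
  obtain ⟨c, hc⟩ := exists_trace_smul_eq V
  have hv := Submodule.mem_span_singleton_self (R := ℂ) v
  obtain ⟨d, hd⟩ := Submodule.mem_span_singleton.mp <|
    single_r_smul_mem (N := ℂ ∙ v) (fun x hx => hc x ▸ Submodule.smul_mem _ c hx) hv
      (ha ▸ Submodule.smul_mem _ a hv) i
  exact ⟨d, hd.symm⟩

end DihedralGroup

/-- Every irreducible complex representation of the infinite dihedral group is
monomial. -/
theorem isMonomial_of_isSimpleModule_infiniteDihedral (V : Type*) [AddCommGroup V]
    [Module (MonoidAlgebra ℂ (DihedralGroup 0)) V]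
    (hV : IsSimpleModule (MonoidAlgebra ℂ (DihedralGroup 0)) V) :
    IsMonomial (DihedralGroup 0) V := by
  let _ : Module ℂ V := Module.compHom V (algebraMap ℂ (MonoidAlgebra ℂ (DihedralGroup 0)))
  have : IsScalarTower ℂ (MonoidAlgebra ℂ (DihedralGroup 0)) V :=
    ⟨fun c a v => by rw [Algebra.smul_def, mul_smul]; rfl⟩
  obtain ⟨v, hv, a, ha⟩ := DihedralGroup.exists_eigenvector_r V
  by_cases hs : ∃ b : ℂ,
      (single (.sr 0) 1 : MonoidAlgebra ℂ (DihedralGroup 0)) • v = b • v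
  · obtain ⟨b, hb⟩ := hs
    refine isMonomial_of_linearIndependent_transversal ⊤ hv (fun g => ?_)
      (fun _ : Unit => 1) (fun g => ⟨(), Subgroup.mem_top _⟩) ?_
    · obtain ⟨i | i, -⟩ := g
      · exact DihedralGroup.exists_single_r_smul_eq ha i
      · obtain ⟨c, hc⟩ := DihedralGroup.exists_single_r_smul_eq ha (-i)
        refine ⟨b * c, ?_⟩
        rw [mul_smul, ← hc, ← single_smul_comm, ← hb, single_smul_single_smul,
          DihedralGroup.r_mul_sr, zero_sub, neg_neg]
    · simpa only [single_one_smul] using LinearIndependent.of_subsingleton () hv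
  · refine isMonomial_of_linearIndependent_transversal
      (Subgroup.zpowers (DihedralGroup.r 1)) hv ?_ ![1, .sr 0] ?_ ?_
    · rintro ⟨_, k, rfl⟩
      simp only [DihedralGroup.r_one_zpow]
      exact DihedralGroup.exists_single_r_smul_eq ha _
    · have hr (i : ZMod 0) : DihedralGroup.r i ∈ Subgroup.zpowers (DihedralGroup.r 1) := by
        obtain ⟨k, rfl⟩ := ZMod.intCast_surjective i
        exact ⟨k, DihedralGroup.r_one_zpow k⟩
      rintro (i | i)
      · exact ⟨0, by simpa using hr i⟩
      · exact ⟨1, by simpa using hr i⟩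
    · have hv' : (single 1 1 : MonoidAlgebra ℂ (DihedralGroup 0)) • v ≠ 0 := by
        rwa [single_one_smul]
      have he : (fun i => (single (![1, .sr 0] i) 1 : MonoidAlgebra ℂ (DihedralGroup 0)) • v) =
          ![(single 1 1 : MonoidAlgebra ℂ (DihedralGroup 0)) • v,
            (single (.sr 0) 1 : MonoidAlgebra ℂ (DihedralGroup 0)) • v] :=
        funext (Fin.forall_fin_two.mpr ⟨rfl, rfl⟩)
      rw [he]
      exact (LinearIndependent.pair_iff' hv').mpr fun b hb =>
        hs ⟨b, by rw [← hb, single_one_smul]⟩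
end

section
/- Every irreducible ℂ-representation of the infinite dihedral group D∞ is finite dimensional; that is, every simple module over the monoid algebra ℂ[D∞] is finite-dimensional as a ℂ-vector space. -/
open scoped TensorProduct

open Polynomial

/-- A two-sided sequence satisfying `f (i + 1) + f (i - 1) = t • f i` takes values in the span of
`f 0` and `f 1`. -/
theorem mem_of_two_term_recurrence {R M : Type*} [Ring R] [AddCommGroup M] [Module R M]
    (W : Submodule R M) (t : R) (f : ℤ → M) (hf : ∀ i, f (i + 1) + f (i - 1) = t • f i)
    (h0 : f 0 ∈ W) (h1 : f 1 ∈ W) (i : ℤ) : f i ∈ W := by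
  suffices h : f i ∈ W ∧ f (i + 1) ∈ W from h.1
  induction i with
  | zero => exact ⟨h0, by simpa using h1⟩
  | succ n ih =>
    refine ⟨ih.2, ?_⟩
    have h := hf (n + 1)
    rw [add_sub_cancel_right] at h
    rw [eq_sub_of_add_eq h]
    exact W.sub_mem (W.smul_mem _ ih.2) ih.1
  | pred n ih =>
    rw [sub_add_cancel]
    refine ⟨?_, ih.1⟩
    rw [eq_sub_of_add_eq' (hf (-n))]
    exact W.sub_mem (W.smul_mem _ ih.1) ih.2

namespace DihedralGroup

/-- The element `r + r⁻¹` of the group algebra of the infinite dihedral group. -/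
noncomputable def rotationSum (k : Type*) [CommRing k] : MonoidAlgebra k (DihedralGroup 0) :=
  MonoidAlgebra.of k _ (r 1) + MonoidAlgebra.of k _ (r (-1))

theorem of_r_mul_rotationSum (k : Type*) [CommRing k] (i : ℤ) :
    MonoidAlgebra.of k (DihedralGroup 0) (r i) * rotationSum k =
      MonoidAlgebra.of k _ (r (i + 1 : ℤ)) + MonoidAlgebra.of k _ (r (i - 1 : ℤ)) := by
  rw [rotationSum, mul_add, ← map_mul, ← map_mul]
  rfl

theorem of_sr_mul_rotationSum (k : Type*) [CommRing k] (i : ℤ) :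
    MonoidAlgebra.of k (DihedralGroup 0) (sr i) * rotationSum k =
      MonoidAlgebra.of k _ (sr (i + 1 : ℤ)) + MonoidAlgebra.of k _ (sr (i - 1 : ℤ)) := by
  rw [rotationSum, mul_add, ← map_mul, ← map_mul]
  rfl

theorem rotationSum_commute (k : Type*) [CommRing k] (a : MonoidAlgebra k (DihedralGroup 0)) :
    Commute (rotationSum k) a := by
  induction a using MonoidAlgebra.induction_on with
  | of g =>
    rw [Commute, SemiconjBy, rotationSum, add_mul, mul_add]
    simp only [← map_mul]
    cases g with
    | r i => rw [r_mul_r, r_mul_r, r_mul_r, r_mul_r, add_comm 1 i, add_comm (-1) i]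
    | sr i =>
      rw [r_mul_sr, r_mul_sr, sr_mul_r, sr_mul_r, sub_neg_eq_add, ← sub_eq_add_neg, add_comm]
  | add a b ha hb => exact ha.add_right hb
  | smul c a ha => exact ha.smul_right c

/-- A cyclic module over the group algebra of the infinite dihedral group is finitely generated
over any ring of scalars in which `r + r⁻¹` acts as a scalar. -/
theorem moduleFinite_of_rotationSum_smul {k R V : Type*} [CommRing k] [Ring R] [SMul k R]
    [AddCommGroup V] [Module k V] [Module (MonoidAlgebra k (DihedralGroup 0)) V]
    [IsScalarTower k (MonoidAlgebra k (DihedralGroup 0)) V] [Module R V] [IsScalarTower k R V]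
    (t : R) (ht : ∀ w : V, rotationSum k • w = t • w) (v : V)
    (hv : Submodule.span (MonoidAlgebra k (DihedralGroup 0)) {v} = ⊤) : Module.Finite R V := by
  let e (g : DihedralGroup 0) : V := MonoidAlgebra.of k _ g • v
  let S : Set V := {e (r 0), e (r 1), e (sr 0), e (sr 1)}
  have hS : S.Finite := by simp [S]
  refine ⟨Submodule.fg_def.mpr ⟨S, hS, ?_⟩⟩
  set W := Submodule.span R S
  have hW : ∀ w ∈ S, w ∈ W := fun w hw => Submodule.subset_span hw
  have hr (i : ℤ) : e (r i) ∈ W := by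
    refine mem_of_two_term_recurrence W t (fun i : ℤ => e (r i)) (fun i => ?_)
      (hW _ (.inl rfl)) (hW _ (.inr (.inl rfl))) i
    simp only [e]
    rw [← ht, ← add_smul, ← of_r_mul_rotationSum, ← (rotationSum_commute k _).eq, mul_smul]
  have hsr (i : ℤ) : e (sr i) ∈ W := by
    refine mem_of_two_term_recurrence W t (fun i : ℤ => e (sr i)) (fun i => ?_)
      (hW _ (.inr (.inr (.inl rfl)))) (hW _ (.inr (.inr (.inr rfl)))) i
    simp only [e]
    rw [← ht, ← add_smul, ← of_sr_mul_rotationSum, ← (rotationSum_commute k _).eq, mul_smul]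
  refine eq_top_iff.mpr fun w _ => ?_
  obtain ⟨a, rfl⟩ := Submodule.mem_span_singleton.mp (hv ▸ Submodule.mem_top : w ∈ _)
  induction a using MonoidAlgebra.induction_on with
  | of g =>
    cases g with
    | r i => exact hr i
    | sr i => exact hsr i
  | add a b ha hb => rw [add_smul]; exact W.add_mem (ha trivial) (hb trivial)
  | smul c a ha => rw [smul_assoc]; exact W.smul_of_tower_mem c (ha trivial)

end DihedralGroup

/-- On a nonzero finitely generated `k[X]`-module with `k` algebraically closed, some `X - c` is
not surjective. -/
theorem Polynomial.exists_not_surjective_X_sub_C_smul (k V : Type*) [Field k] [IsAlgClosed k]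
    [AddCommGroup V] [Module k[X] V] [Module.Finite k[X] V] [Nontrivial V] :
    ∃ c : k, ¬ Function.Surjective fun w : V => (X - C c : k[X]) • w := by
  obtain ⟨N, hN, -⟩ := (eq_top_or_exists_le_coatom (⊥ : Submodule k[X] V)).resolve_left bot_ne_top
  have : IsSimpleModule k[X] (V ⧸ N) := isSimpleModule_iff_isCoatom.mpr hN
  have hmax : (Module.annihilator k[X] (V ⧸ N)).IsMaximal := IsSimpleModule.annihilator_isMaximal
  obtain ⟨p, hp⟩ := (IsPrincipalIdealRing.principal (Module.annihilator k[X] (V ⧸ N))).principal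
  have hp' : Module.annihilator k[X] (V ⧸ N) = Ideal.span {p} := hp
  have hdeg : p.degree ≠ 0 := fun h => hmax.ne_top <| by
    rw [hp', Ideal.span_singleton_eq_top]
    exact isUnit_iff_degree_eq_zero.mpr h
  obtain ⟨c, hc⟩ := IsAlgClosed.exists_root p hdeg
  have hle : Ideal.span {p} ≤ Ideal.span {X - C c} :=
    Ideal.span_singleton_le_span_singleton.mpr (dvd_iff_isRoot.mpr hc)
  have hmem : X - C c ∈ Module.annihilator k[X] (V ⧸ N) := by
    rw [hmax.eq_of_le (fun h => not_isUnit_X_sub_C c (Ideal.span_singleton_eq_top.mp h))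
      (hp' ▸ hle)]
    exact Ideal.mem_span_singleton_self _
  refine ⟨c, fun hsurj => hN.1 (eq_top_iff.mpr fun w _ => ?_)⟩
  obtain ⟨u, rfl⟩ := hsurj w
  rw [← Submodule.Quotient.mk_eq_zero, Submodule.Quotient.mk_smul]
  exact Module.mem_annihilator.mp hmem _

/-- A central element of `A` acting non-surjectively on a simple `A`-module acts by zero. -/
theorem IsSimpleModule.smul_eq_zero_of_not_surjective {A V : Type*} [Ring A] [AddCommGroup V]
    [Module A V] [IsSimpleModule A V] {z : A} (hz : ∀ a, Commute z a)
    (hsurj : ¬ Function.Surjective fun w : V => z • w) (w : V) : z • w = 0 := by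
  let T : V →ₗ[A] V :=
    { toFun := fun w => z • w
      map_add' := smul_add z
      map_smul' := fun a w => by simp [← mul_smul, (hz a).eq] }
  exact LinearMap.congr_fun ((T.surjective_or_eq_zero).resolve_left hsurj) w

/-- Every irreducible complex representation of the infinite dihedral group is
finite-dimensional over `ℂ`. -/
theorem finiteDimensional_of_isSimpleModule_infiniteDihedral (V : Type*)
    [AddCommGroup V] [Module ℂ V] [Module (MonoidAlgebra ℂ (DihedralGroup 0)) V]
    [IsScalarTower ℂ (MonoidAlgebra ℂ (DihedralGroup 0)) V]
    (hV : IsSimpleModule (MonoidAlgebra ℂ (DihedralGroup 0)) V) :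
    FiniteDimensional ℂ V := by
  have := IsSimpleModule.nontrivial (MonoidAlgebra ℂ (DihedralGroup 0)) V
  obtain ⟨v, hv0⟩ := exists_ne (0 : V)
  have hv := IsSimpleModule.span_singleton_eq_top (MonoidAlgebra ℂ (DihedralGroup 0)) hv0
  let z := DihedralGroup.rotationSum ℂ
  let : Module ℂ[X] V := Module.compHom V (aeval z : ℂ[X] →ₐ[ℂ] _).toRingHom
  have hsmul (p : ℂ[X]) (w : V) : p • w = aeval z p • w := rfl
  have : IsScalarTower ℂ ℂ[X] V := ⟨fun c p w => by rw [hsmul, hsmul, map_smul, smul_assoc]⟩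
  have : Module.Finite ℂ[X] V :=
    DihedralGroup.moduleFinite_of_rotationSum_smul (k := ℂ) X
      (fun w => by rw [hsmul, aeval_X]) v hv
  obtain ⟨c, hc⟩ := Polynomial.exists_not_surjective_X_sub_C_smul ℂ V
  simp only [hsmul, map_sub, aeval_X, aeval_C] at hc
  have hzero := IsSimpleModule.smul_eq_zero_of_not_surjective
    (fun a => (DihedralGroup.rotationSum_commute ℂ a).sub_left (Algebra.commutes c a)) hc
  refine DihedralGroup.moduleFinite_of_rotationSum_smul (k := ℂ) c (fun w => ?_) v hv
  have h := hzero w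
  rwa [sub_smul, algebraMap_smul, sub_eq_zero] at h
end

section
/- Let G be a supersolvable group and let V be an irreducible ℂ-representation of G (a simple ℂ[G]-module) that is finite-dimensional as a ℂ-vector space. Then V is monomial, i.e. V is isomorphic as a ℂ[G]-module to Ind_H^G(χ) for some subgroup H ≤ G and character χ : H →* ℂˣ. -/
open scoped TensorProduct

namespace Representation

variable {k G V : Type*} [Field k] [Group G] [AddCommGroup V] [Module k V]

/-- The `G`-translates of `W` are independent, i.e. `W` is a block of a system of imprimitivity
for its span. -/
def IsBlock (ρ : Representation k G V) (W : Submodule k V) : Prop :=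
  sSupIndep (Set.range fun g => W.map (ρ g))

/-- The setwise stabilizer of a subspace. -/
def stabilizerSubgroup (ρ : Representation k G V) (W : Submodule k V) : Subgroup G where
  carrier := {g | W.map (ρ g) = W}
  one_mem' := by simp [Module.End.one_eq_id]
  mul_mem' {a b} ha hb := by
    simp only [Set.mem_ofPred_eq] at *
    rw [map_mul, Module.End.mul_eq_comp, Submodule.map_comp, hb, ha]
  inv_mem' {a} ha := by
    simp only [Set.mem_ofPred_eq] at *
    conv_lhs => rw [← ha]
    rw [← Submodule.map_comp, ← Module.End.mul_eq_comp, ← map_mul]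
    simp [Module.End.one_eq_id]

/-- The elements acting on `W` through scalars. -/
def scalarSubgroup (ρ : Representation k G V) (W : Submodule k V) : Subgroup G where
  carrier := {g | ∃ c : kˣ, ∀ w ∈ W, ρ g w = (c : k) • w}
  one_mem' := ⟨1, by simp⟩
  mul_mem' := by
    rintro a b ⟨c, hc⟩ ⟨d, hd⟩
    refine ⟨c * d, fun w hw => ?_⟩
    simp [hd w hw, hc w hw, mul_smul, smul_comm (c : k)]
  inv_mem' := by
    rintro a ⟨c, hc⟩
    refine ⟨c⁻¹, fun w hw => ?_⟩
    have h : ρ a⁻¹ (ρ a w) = w := by simp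
    rw [hc w hw, map_smul] at h
    rw [Units.val_inv_eq_inv_val, eq_inv_smul_iff₀ c.ne_zero, h]

variable {ρ : Representation k G V} {U W : Submodule k V}

theorem map_map_eq_map_mul (g h : G) : (U.map (ρ h)).map (ρ g) = U.map (ρ (g * h)) := by
  rw [map_mul, Module.End.mul_eq_comp, Submodule.map_comp]

theorem injective_apply (ρ : Representation k G V) (g : G) : Function.Injective (ρ g) := by
  intro x y h
  simpa using congrArg (ρ g⁻¹) h

theorem isBlock_top (ρ : Representation k G V) : ρ.IsBlock ⊤ := by
  have h : (Set.range fun g => (⊤ : Submodule k V).map (ρ g)) ⊆ {⊤} := by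
    rintro _ ⟨g, rfl⟩
    exact (Submodule.map_top _).trans <| LinearMap.range_eq_top.2 fun v => ⟨ρ g⁻¹ v, by simp⟩
  exact (sSupIndep_singleton _).mono h

theorem IsBlock.trans (hW : ρ.IsBlock W) (hUW : U ≤ W)
    (hU : sSupIndep (Set.range fun h : ρ.stabilizerSubgroup W => U.map (ρ (h : G)))) :
    ρ.IsBlock U := by
  rintro _ ⟨a, rfl⟩
  have h1 := Submodule.disjoint_map (ρ.injective_apply a) (hU ⟨1, rfl⟩)
  have h2 := hW ⟨a, rfl⟩
  simp only [OneMemClass.coe_one, map_one, Module.End.one_eq_id, Submodule.map_id] at h1 h2 ⊢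
  have hle : sSup ((Set.range fun h : ρ.stabilizerSubgroup W => U.map (ρ (h : G))) \ {U}) ≤ W := by
    refine sSup_le ?_
    rintro _ ⟨⟨h, rfl⟩, -⟩
    exact (Submodule.map_mono hUW).trans_eq h.2
  refine (h1.disjoint_sup_right_of_disjoint_sup_left
    (h2.mono_left (sup_le (Submodule.map_mono hUW) (Submodule.map_mono hle)))).mono_right ?_
  refine sSup_le ?_
  rintro _ ⟨⟨g, rfl⟩, hg⟩
  by_cases hgW : W.map (ρ g) = W.map (ρ a)
  · have hmem : a⁻¹ * g ∈ ρ.stabilizerSubgroup W := by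
      change W.map (ρ (a⁻¹ * g)) = W
      rw [← map_map_eq_map_mul, hgW, map_map_eq_map_mul]
      simp [Module.End.one_eq_id]
    have hag : U.map (ρ g) = (U.map (ρ (a⁻¹ * g))).map (ρ a) := by
      rw [map_map_eq_map_mul, mul_inv_cancel_left]
    refine le_sup_of_le_left ?_
    refine hag.trans_le ?_
    refine Submodule.map_mono (le_sSup ⟨⟨⟨_, hmem⟩, rfl⟩, fun h => hg ?_⟩)
    rw [Set.mem_singleton_iff] at h ⊢
    exact hag.trans (congrArg _ h)
  · exact le_sup_of_le_right
      ((Submodule.map_mono hUW).trans (le_sSup ⟨⟨g, rfl⟩, hgW⟩))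

/-- If `M` is normalized by `H` and acts by scalars on each eigenspace of `g ∈ M`, then `H` permutes
the eigenspaces of `g`. -/
theorem map_inf_eigenspace_mem_range {H M : Subgroup G} (hH : H ≤ ρ.stabilizerSubgroup W)
    (hM : ∀ h ∈ H, ∀ x ∈ M, h * x * h⁻¹ ∈ M) {g : G} (hg : g ∈ M)
    (hscalar : ∀ c, M ≤ ρ.scalarSubgroup (W ⊓ Module.End.eigenspace (ρ g) c)) {l : k}
    (hl : W ⊓ Module.End.eigenspace (ρ g) l ≠ ⊥) {h : G} (hh : h ∈ H) :
    ∃ c, (W ⊓ Module.End.eigenspace (ρ g) l).map (ρ h) =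
      W ⊓ Module.End.eigenspace (ρ g) c := by
  have key : ∀ h ∈ H, ∀ l, ∃ c, (W ⊓ Module.End.eigenspace (ρ g) l).map (ρ h) ≤
      W ⊓ Module.End.eigenspace (ρ g) c := by
    intro h hh l
    obtain ⟨c, hc⟩ := hscalar l (hM _ (inv_mem hh) _ hg)
    refine ⟨c, ?_⟩
    rintro _ ⟨w, hw, rfl⟩
    refine ⟨(hH hh).le ⟨w, hw.1, rfl⟩, Module.End.mem_eigenspace_iff.2 ?_⟩
    have := congrArg (ρ h) (hc w hw)
    rw [map_smul, ← Module.End.mul_apply, ← map_mul] at this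
    rw [← this, ← Module.End.mul_apply, ← map_mul]
    congr 2
    group
  obtain ⟨c, hc⟩ := key h hh l
  obtain ⟨d, hd⟩ := key h⁻¹ (inv_mem hh) c
  have hld : W ⊓ Module.End.eigenspace (ρ g) l ≤ W ⊓ Module.End.eigenspace (ρ g) d := by
    refine le_trans ?_ ((Submodule.map_mono hc).trans hd)
    rw [map_map_eq_map_mul]
    simp [Module.End.one_eq_id]
  have hdl : d = l := by
    by_contra hne
    have hdisj := (Module.End.eigenspaces_iSupIndep (ρ g)).pairwiseDisjoint (Ne.symm hne)
    exact hl (disjoint_self.1 (hdisj.mono inf_le_right (hld.trans inf_le_right)))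
  subst hdl
  refine ⟨c, hc.antisymm ?_⟩
  have := Submodule.map_mono (f := ρ h) hd
  rw [map_map_eq_map_mul] at this
  simpa [Module.End.one_eq_id] using this

end Representation

theorem Subgroup.exists_mul_inv_mem_of_sup_closure {G : Type*} [Group G] (K : Subgroup G)
    [K.Normal] (g : G) {M : Subgroup G} (hM : M ≤ K ⊔ closure {g}) :
    ∃ y ∈ M, ∀ x ∈ M, ∃ n : ℤ, x * (y ^ n)⁻¹ ∈ K := by
  have hle : M.map (QuotientGroup.mk' K) ≤ zpowers (g : G ⧸ K) := by
    refine (map_mono hM).trans ?_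
    rw [map_sup, QuotientGroup.map_mk'_self, bot_sup_eq, ← zpowers_eq_closure,
      MonoidHom.map_zpowers]
    rfl
  have := Subgroup.isCyclic_of_le hle
  obtain ⟨⟨_, y, hy, rfl⟩, hgen⟩ := IsCyclic.exists_generator (α := M.map (QuotientGroup.mk' K))
  refine ⟨y, hy, fun x hx => ?_⟩
  obtain ⟨n, hn⟩ := hgen ⟨_, x, hx, rfl⟩
  refine ⟨n, ?_⟩
  rw [← QuotientGroup.eq_one_iff]
  have hn' := congrArg Subtype.val hn
  simp only [coe_zpow, QuotientGroup.mk'_apply] at hn'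
  simp [← hn']

namespace Representation

variable {k G V : Type*} [Field k] [IsAlgClosed k] [Group G] [AddCommGroup V] [Module k V]
  [FiniteDimensional k V] {ρ : Representation k G V}

theorem stabilizer_inf_le_scalarSubgroup {W : Submodule k V}
    (hW : Minimal (fun W => W ≠ ⊥ ∧ ρ.IsBlock W) W) {N K : Subgroup G} [N.Normal] [K.Normal]
    {g : G} (hN : N = K ⊔ Subgroup.closure {g})
    (hK : ρ.stabilizerSubgroup W ⊓ K ≤ ρ.scalarSubgroup W) :
    ρ.stabilizerSubgroup W ⊓ N ≤ ρ.scalarSubgroup W := by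
  obtain ⟨y, hy, hgen⟩ := K.exists_mul_inv_mem_of_sup_closure g
    (M := ρ.stabilizerSubgroup W ⊓ N) (inf_le_right.trans hN.le)
  have hscalar : ∀ c, ρ.stabilizerSubgroup W ⊓ N ≤
      ρ.scalarSubgroup (W ⊓ Module.End.eigenspace (ρ y) c) := by
    intro c x hx
    obtain ⟨n, hn⟩ := hgen x hx
    have hyc : y ∈ ρ.scalarSubgroup (W ⊓ Module.End.eigenspace (ρ y) c) := by
      rcases eq_or_ne c 0 with rfl | hc
      · refine ⟨1, fun w hw => ?_⟩
        have h0 : ρ y w = 0 := by simpa using hw.2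
        have : w = 0 := ρ.injective_apply y (h0.trans (map_zero _).symm)
        simp [this]
      · exact ⟨Units.mk0 c hc, fun w hw => Module.End.mem_eigenspace_iff.1 hw.2⟩
    obtain ⟨d, hd⟩ := hK (Subgroup.mem_inf.2
      ⟨mul_mem (Subgroup.mem_inf.1 hx).1 (inv_mem (zpow_mem (Subgroup.mem_inf.1 hy).1 n)), hn⟩)
    have := mul_mem (show x * (y ^ n)⁻¹ ∈ ρ.scalarSubgroup (W ⊓ Module.End.eigenspace (ρ y) c) from
      ⟨d, fun w hw => hd w hw.1⟩) (zpow_mem hyc n)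
    simpa using this
  obtain ⟨l, hl⟩ : ∃ l, W ⊓ Module.End.eigenspace (ρ y) l ≠ ⊥ := by
    have : Nontrivial W := Submodule.nontrivial_iff_ne_bot.2 hW.prop.1
    obtain ⟨l, hl⟩ := Module.End.exists_eigenvalue
      ((ρ y).restrict (p := W) (q := W) fun w hw => hy.1.le ⟨w, hw, rfl⟩)
    obtain ⟨w, hw⟩ := hl.exists_hasEigenvector
    refine ⟨l, (Submodule.ne_bot_iff _).2 ⟨w, ⟨w.2, Module.End.mem_eigenspace_iff.2 ?_⟩, ?_⟩⟩
    · exact congrArg Subtype.val hw.apply_eq_smul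
    · simpa using hw.2
  have hblock : ρ.IsBlock (W ⊓ Module.End.eigenspace (ρ y) l) := by
    refine hW.prop.2.trans inf_le_left ?_
    refine (((Module.End.eigenspaces_iSupIndep (ρ y)).mono fun c =>
      (inf_le_right : W ⊓ _ ≤ _)).sSupIndep_range).mono ?_
    rintro _ ⟨h, rfl⟩
    obtain ⟨c, hc⟩ := map_inf_eigenspace_mem_range (le_refl (ρ.stabilizerSubgroup W))
      (fun h hh x hx =>
      Subgroup.mem_inf.2 ⟨mul_mem (mul_mem hh (Subgroup.mem_inf.1 hx).1) (inv_mem hh),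
        Subgroup.Normal.conj_mem ‹_› x (Subgroup.mem_inf.1 hx).2 h⟩)
      hy hscalar hl h.2
    exact ⟨c, hc.symm⟩
  have heq := hW.eq_of_le ⟨hl, hblock⟩ inf_le_left
  have hl' := hscalar l
  rwa [heq] at hl'

theorem exists_isBlock_span_singleton [Nontrivial V] (hG : IsSupersolvable G)
    (ρ : Representation k G V) : ∃ v ≠ 0, ρ.IsBlock (k ∙ v) := by
  obtain ⟨W, hW⟩ := exists_minimal_of_wellFoundedLT (fun W => W ≠ ⊥ ∧ ρ.IsBlock W)
    ⟨⊤, top_ne_bot, ρ.isBlock_top⟩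
  obtain ⟨n, N, h0, hn, -, hnormal, hcyc⟩ := hG
  have hscalar : ρ.stabilizerSubgroup W ⊓ N 0 ≤ ρ.scalarSubgroup W := by
    refine Nat.decreasingInduction
      (motive := fun i _ => ρ.stabilizerSubgroup W ⊓ N i ≤ ρ.scalarSubgroup W)
      (fun i hi ih => ?_) (by simp [hn]) (Nat.zero_le (n + 1))
    obtain ⟨g, hg⟩ := hcyc i (Nat.lt_succ_iff.1 hi)
    have := hnormal i
    have := hnormal (i + 1)
    exact stabilizer_inf_le_scalarSubgroup hW hg ih
  rw [h0, inf_top_eq] at hscalar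
  obtain ⟨v, hv, hv0⟩ := (Submodule.ne_bot_iff _).1 hW.prop.1
  refine ⟨v, hv0, hW.prop.2.trans ((Submodule.span_singleton_le_iff_mem _ _).2 hv) ?_⟩
  refine (sSupIndep_singleton (k ∙ v)).mono ?_
  rintro _ ⟨h, rfl⟩
  obtain ⟨c, hc⟩ := hscalar h.2
  simp only [Set.mem_singleton_iff, Submodule.map_span, Set.image_singleton, hc v hv]
  exact Submodule.span_singleton_group_smul_eq k c v

end Representation

section Induced

variable {G : Type*} [Group G] {V : Type*} [AddCommGroup V] [Module ℂ V]
  [Module (MonoidAlgebra ℂ G) V] [IsScalarTower ℂ (MonoidAlgebra ℂ G) V]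

theorem isMonomial_of_linearIndependent [IsSimpleModule (MonoidAlgebra ℂ G) V]
    {H : Subgroup G} {χ : H →* ℂˣ} {v : V} (hv : v ≠ 0)
    (hχ : ∀ h : H, MonoidAlgebra.single (h : G) (1 : ℂ) • v = (χ h : ℂ) • v)
    (hind : LinearIndependent ℂ
      fun q : G ⧸ H => MonoidAlgebra.single (Quotient.out q) (1 : ℂ) • v) :
    IsMonomial G V := by
  let I := Submodule.span (MonoidAlgebra ℂ G)
    {x : MonoidAlgebra ℂ G | ∃ h : H,
      x = MonoidAlgebra.single (h : G) (1 : ℂ) - (χ h : ℂ) • (1 : MonoidAlgebra ℂ G)}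
  have hker : I ≤ LinearMap.ker (LinearMap.toSpanSingleton (MonoidAlgebra ℂ G) V v) := by
    refine Submodule.span_le.2 ?_
    rintro _ ⟨h, rfl⟩
    simp [sub_smul, hχ]
  have hrep : ∀ a : MonoidAlgebra ℂ G, ∃ b : G ⧸ H →₀ ℂ,
      a - Finsupp.linearCombination ℂ
        (fun q : G ⧸ H => MonoidAlgebra.single (Quotient.out q) (1 : ℂ)) b ∈ I := by
    intro a
    induction a using MonoidAlgebra.induction_linear with
    | zero => exact ⟨0, by simp⟩
    | add x y hx hy =>
      obtain ⟨b, hb⟩ := hx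
      obtain ⟨c, hc⟩ := hy
      refine ⟨b + c, ?_⟩
      rw [map_add, add_sub_add_comm]
      exact add_mem hb hc
    | single g r =>
      obtain ⟨h, hh⟩ := QuotientGroup.mk_out_eq_mul H g
      have hmem : MonoidAlgebra.single ((h⁻¹ : H) : G) (1 : ℂ) -
          (χ h⁻¹ : ℂ) • (1 : MonoidAlgebra ℂ G) ∈ I := Submodule.subset_span ⟨h⁻¹, rfl⟩
      refine ⟨Finsupp.single (g : G ⧸ H) (r * (χ h⁻¹ : ℂ)), ?_⟩
      rw [Finsupp.linearCombination_single, hh]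
      convert I.smul_mem (MonoidAlgebra.single (g * h) r) hmem using 1
      simp [mul_sub, MonoidAlgebra.one_def, MonoidAlgebra.single_mul_single]
  have hle : LinearMap.ker (LinearMap.toSpanSingleton (MonoidAlgebra ℂ G) V v) ≤ I := by
    intro a ha
    obtain ⟨b, hb⟩ := hrep a
    have hb0 := hker hb
    have hb' : Finsupp.linearCombination ℂ
        (fun q : G ⧸ H => MonoidAlgebra.single (Quotient.out q) (1 : ℂ) • v) b = 0 := by
      rw [LinearMap.mem_ker, map_sub, LinearMap.mem_ker.1 ha, zero_sub, neg_eq_zero,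
        LinearMap.toSpanSingleton_apply, Finsupp.linearCombination_apply, Finsupp.sum,
        Finset.sum_smul] at hb0
      simpa only [Finsupp.linearCombination_apply, Finsupp.sum, smul_assoc] using hb0
    have : b = 0 := linearIndependent_iff.1 hind b hb'
    simpa [this] using hb
  exact ⟨H, χ, ⟨((Submodule.quotEquivOfEq _ _ (hker.antisymm hle)).trans
    (LinearMap.quotKerEquivOfSurjective _
      (IsSimpleModule.toSpanSingleton_surjective _ hv))).symm⟩⟩

end Induced

theorem Representation.IsBlock.linearIndependent_out {k G V : Type*} [Field k] [Group G]
    [AddCommGroup V] [Module k V] {ρ : Representation k G V} {v : V} (hv : v ≠ 0)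
    (h : ρ.IsBlock (k ∙ v)) :
    LinearIndependent k
      fun q : G ⧸ ρ.stabilizerSubgroup (k ∙ v) => ρ (Quotient.out q) v := by
  refine iSupIndep.linearIndependent (fun q => (k ∙ v).map (ρ (Quotient.out q))) ?_
    (fun q => ⟨v, Submodule.mem_span_singleton_self v, rfl⟩)
    (fun q h0 => hv (ρ.injective_apply _ (h0.trans (map_zero _).symm)))
  refine ((sSupIndep_iff _).1 h).comp (f := fun q : G ⧸ ρ.stabilizerSubgroup (k ∙ v) =>
    ⟨(k ∙ v).map (ρ (Quotient.out q)), _, rfl⟩) fun p q hpq => ?_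
  have hpq' : (k ∙ v).map (ρ p.out) = (k ∙ v).map (ρ q.out) := congrArg Subtype.val hpq
  rw [← QuotientGroup.out_eq' p, ← QuotientGroup.out_eq' q, QuotientGroup.eq]
  change (k ∙ v).map (ρ (p.out⁻¹ * q.out)) = _
  rw [← map_map_eq_map_mul, ← hpq', map_map_eq_map_mul]
  simp [Module.End.one_eq_id]

/-- Every finite-dimensional irreducible complex representation of a supersolvable
group is monomial. -/
theorem isMonomial_of_finiteDimensional (G : Type*) [Group G]
    (hG : IsSupersolvable G) (V : Type*) [AddCommGroup V] [Module ℂ V]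
    [Module (MonoidAlgebra ℂ G) V] [IsScalarTower ℂ (MonoidAlgebra ℂ G) V]
    (hV : IsSimpleModule (MonoidAlgebra ℂ G) V) (hfd : FiniteDimensional ℂ V) :
    IsMonomial G V := by
  have : Nontrivial V := IsSimpleModule.nontrivial (MonoidAlgebra ℂ G) V
  let ρ : Representation ℂ G V :=
    ((Algebra.lsmul ℂ ℂ V : MonoidAlgebra ℂ G →ₐ[ℂ] Module.End ℂ V) :
      MonoidAlgebra ℂ G →* Module.End ℂ V).comp (MonoidAlgebra.of ℂ G)
  obtain ⟨v, hv, hblock⟩ := ρ.exists_isBlock_span_singleton hG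
  have hex : ∀ h : ρ.stabilizerSubgroup (ℂ ∙ v), ∃ c : ℂ, c • v = ρ (h : G) v := fun h =>
    Submodule.mem_span_singleton.1 (h.2.le ⟨v, Submodule.mem_span_singleton_self v, rfl⟩)
  choose c hc using hex
  let χ : ρ.stabilizerSubgroup (ℂ ∙ v) →* ℂ :=
    { toFun := c
      map_one' := smul_left_injective ℂ hv (by simp [hc])
      map_mul' := fun a b => smul_left_injective ℂ hv (by
        simp only [hc, Subgroup.coe_mul, map_mul, Module.End.mul_apply]
        rw [← hc b, map_smul, ← hc a, smul_smul, mul_comm]) }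
  exact isMonomial_of_linearIndependent (χ := χ.toHomUnits) hv (fun h => (hc h).symm)
    (hblock.linearIndependent_out hv)
end

section
/- Every subgroup H of a supersolvable group G is a subproximate normal subgroup of G: there exists a finite chain of subgroups H = H_0 ≤ H_1 ≤ ⋯ ≤ H_k = G such that for each i, H_i is proximate normal in H_{i+1}. -/
open scoped TensorProduct

/-- `H` is proximate normal in `G`: for every `g ∈ G`, the subgroup `H ∩ gHg⁻¹` is a
normal subgroup of `H` of finite index and the quotient `H/(H ∩ gHg⁻¹)` is abelian
(i.e. all commutators of elements of `H` lie in `H ∩ gHg⁻¹`). -/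
def IsProximateNormal {G : Type*} [Group G] (H : Subgroup G) : Prop :=
  ∀ g : G,
    (∀ k ∈ H ⊓ Subgroup.map (MulAut.conj g).toMonoidHom H,
      ∀ h ∈ H, h * k * h⁻¹ ∈ H ⊓ Subgroup.map (MulAut.conj g).toMonoidHom H) ∧
    ((H ⊓ Subgroup.map (MulAut.conj g).toMonoidHom H).subgroupOf H).index ≠ 0 ∧
    (∀ a ∈ H, ∀ b ∈ H, a * b * a⁻¹ * b⁻¹ ∈ H ⊓ Subgroup.map (MulAut.conj g).toMonoidHom H)

/-- If `H` meets the kernel of a homomorphism to a finite commutative group inside each of its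
conjugates, then `H` is proximate normal. -/
theorem isProximateNormal_of_inf_ker_le {G A : Type*} [Group G] [CommGroup A] [Finite A]
    (f : G →* A) (H : Subgroup G)
    (hf : ∀ g : G, H ⊓ f.ker ≤ Subgroup.map (MulAut.conj g).toMonoidHom H) :
    IsProximateNormal H := by
  intro g
  have hcomm : ∀ a ∈ H, ∀ b ∈ H,
      a * b * a⁻¹ * b⁻¹ ∈ H ⊓ Subgroup.map (MulAut.conj g).toMonoidHom H := by
    intro a ha b hb
    have hab : a * b * a⁻¹ * b⁻¹ ∈ H :=
      H.mul_mem (H.mul_mem (H.mul_mem ha hb) (H.inv_mem ha)) (H.inv_mem hb)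
    refine ⟨hab, hf g ⟨hab, ?_⟩⟩
    simp [mul_comm (f a) (f b)]
  refine ⟨fun k hk h hh => ?_, ?_, hcomm⟩
  · simpa using Subgroup.mul_mem _ (hcomm h hh k hk.1) hk
  · have hker : (f.ker.subgroupOf H).FiniteIndex := inferInstance
    have hle : f.ker.subgroupOf H ≤
        (H ⊓ Subgroup.map (MulAut.conj g).toMonoidHom H).subgroupOf H := by
      intro x hx
      exact ⟨x.2, hf g ⟨x.2, hx⟩⟩
    exact (Subgroup.finiteIndex_of_le hle).index_ne_zero

/-- If `M ≤ N` are normal subgroups with `N / M` cyclic and `M ≤ K`, then `K` is proximate normal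
in `K ⊔ N`. -/
theorem isProximateNormal_subgroupOf_sup {G : Type*} [Group G] (M N K : Subgroup G)
    [M.Normal] [N.Normal] (hMK : M ≤ K) (a : G) (hN : N = M ⊔ Subgroup.closure {a}) :
    IsProximateNormal (K.subgroupOf (K ⊔ N)) := by
  let P : Subgroup (G ⧸ M) := N.map (QuotientGroup.mk' M)
  have hP : P.Normal := Subgroup.Normal.map ‹_› _ (QuotientGroup.mk'_surjective M)
  have hPa : P = Subgroup.zpowers (QuotientGroup.mk' M a) := by
    simp only [P, hN, Subgroup.map_sup, QuotientGroup.map_mk'_self, bot_sup_eq,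
      MonoidHom.map_closure, Set.image_singleton, Subgroup.zpowers_eq_closure]
  have hcyc : IsCyclic P := by
    rw [hPa]
    infer_instance
  let φ : G →* (ZMod (Nat.card P))ˣ :=
    (IsCyclic.mulAutMulEquiv P).toMonoidHom.comp
      (MulAut.conjNormal.comp (QuotientGroup.mk' M))
  have hφ : ∀ h ∈ φ.ker, ∀ n ∈ N, n⁻¹ * h * n * h⁻¹ ∈ M := by
    intro h hh n hn
    have h1 : MulAut.conjNormal (H := P) (QuotientGroup.mk' M h) = 1 := by
      simpa [φ, MonoidHom.mem_ker] using hh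
    have h2 := congrArg Subtype.val
      (DFunLike.congr_fun h1 ⟨QuotientGroup.mk' M n, Subgroup.mem_map_of_mem _ hn⟩)
    rw [MulAut.conjNormal_apply] at h2
    have h3 : QuotientGroup.mk' M h * QuotientGroup.mk' M n =
        QuotientGroup.mk' M n * QuotientGroup.mk' M h := mul_inv_eq_iff_eq_mul.mp h2
    rw [← QuotientGroup.ker_mk' M, MonoidHom.mem_ker]
    simp only [map_mul, map_inv]
    rw [mul_assoc _ (QuotientGroup.mk' M h), h3]
    group
  have : Finite (ZMod (Nat.card P))ˣ := by
    cases Nat.card P with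
    | zero => exact inferInstanceAs (Finite ℤˣ)
    | succ n => infer_instance
  refine isProximateNormal_of_inf_ker_le (φ.comp (K ⊔ N).subtype) _ ?_
  rintro ⟨g, hg⟩ ⟨h, hhL⟩ ⟨hhK, hhφ⟩
  obtain ⟨n, hn, k, hk, rfl⟩ := Subgroup.mem_sup_of_normal_left.mp (sup_comm K N ▸ hg)
  replace hhK : h ∈ K := hhK
  have hconj : n⁻¹ * h * n ∈ K := by
    simpa using K.mul_mem (hMK (hφ h hhφ n hn)) hhK
  have hx : k⁻¹ * (n⁻¹ * h * n) * k ∈ K := K.mul_mem (K.mul_mem (K.inv_mem hk) hconj) hk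
  refine ⟨⟨_, Subgroup.mem_sup_left hx⟩, hx, Subtype.ext ?_⟩
  simp [mul_assoc]

/-- Every subgroup of a supersolvable group is subproximate normal: there is a finite
chain of subgroups from `H` to `G` in which each member is proximate normal in the
next one. -/
theorem exists_subproximate_chain (G : Type*) [Group G] (hG : IsSupersolvable G)
    (H : Subgroup G) :
    ∃ (k : ℕ) (C : ℕ → Subgroup G), C 0 = H ∧ C k = ⊤ ∧
      (∀ i < k, C i ≤ C (i + 1)) ∧
      (∀ i < k, IsProximateNormal ((C i).subgroupOf (C (i + 1)))) := by
  obtain ⟨k, N, hN0, hNk, hle, hnormal, hcyc⟩ := hG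
  refine ⟨k + 1, fun i => H ⊔ N (k + 1 - i), by simp [hNk], by simp [hN0], ?_, ?_⟩
  all_goals
    intro i hi
    have h1 : k + 1 - i = (k - i) + 1 := by omega
    have h2 : k + 1 - (i + 1) = k - i := by omega
    beta_reduce
    rw [h1, h2]
  · exact sup_le_sup_left (hle _) H
  · obtain ⟨a, ha⟩ := hcyc (k - i) (Nat.sub_le k i)
    have := hnormal (k - i)
    have := hnormal (k - i + 1)
    have hsup : H ⊔ N (k - i) = (H ⊔ N (k - i + 1)) ⊔ N (k - i) := by
      rw [sup_assoc, sup_eq_right.mpr (hle (k - i))]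
    rw [hsup]
    exact isProximateNormal_subgroupOf_sup _ _ _ le_sup_right a ha
end

section
/- Let G be a group, H a subgroup of G, and χ : H →* ℂˣ a character such that for every g ∈ G with g ∉ H there exists x ∈ H^g ∩ H with χ^g(x) ≠ χ(x). Then the weight space of the induced representation V = Ind_H^G(χ), namely V_H(χ) = {v ∈ V | h • v = χ(h) v for all h ∈ H}, is a one-dimensional ℂ-vector space. -/
open scoped TensorProduct

/-- The weight space `V_H(χ) = {v ∈ V | h • v = χ(h) v for all h ∈ H}` of a
`ℂ[G]`-module `V`. -/
def weightSpace {G : Type*} [Group G] (H : Subgroup G) (χ : H →* ℂˣ)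
    (V : Type*) [AddCommGroup V] [Module ℂ V] [Module (MonoidAlgebra ℂ G) V]
    [IsScalarTower ℂ (MonoidAlgebra ℂ G) V] : Submodule ℂ V where
  carrier := {v | ∀ h : H, (MonoidAlgebra.single (h : G) (1 : ℂ)) • v = (χ h : ℂ) • v}
  add_mem' := fun ha hb h => by rw [smul_add, ha h, hb h, smul_add]
  zero_mem' := fun h => by simp
  smul_mem' := fun c v hv h => by rw [smul_comm, hv h, smul_comm]

namespace IndChar

open MonoidAlgebra

variable {G : Type*} [Group G] (H : Subgroup G) (χ : H →* ℂˣ)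

/-- The coordinates of the class of `g` in `IndChar H χ` with respect to the basis of classes of
chosen representatives of the left cosets of `H`. -/
noncomputable def cosetCoord (g : G) : G ⧸ H →₀ ℂ :=
  Finsupp.single (g : G ⧸ H) (χ ⟨(g : G ⧸ H).out⁻¹ * g, QuotientGroup.eq.1 (g : G ⧸ H).out_eq⟩ : ℂ)

/-- The linear extension of `cosetCoord` to `ℂ[G]`. -/
noncomputable def coord : MonoidAlgebra ℂ G →ₗ[ℂ] G ⧸ H →₀ ℂ :=
  Finsupp.linearCombination ℂ (cosetCoord H χ) ∘ₗ (coeffLinearEquiv ℂ).toLinearMap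

/-- The linear combination of the classes of chosen representatives of the left cosets of `H`
with given coefficients. -/
noncomputable def ofCoord : (G ⧸ H →₀ ℂ) →ₗ[ℂ] IndChar H χ :=
  Finsupp.linearCombination ℂ fun q : G ⧸ H => Submodule.Quotient.mk (single q.out (1 : ℂ))

/-- The submodule of relations defining `IndChar H χ`. -/
noncomputable abbrev relations : Submodule (MonoidAlgebra ℂ G) (MonoidAlgebra ℂ G) :=
  Submodule.span (MonoidAlgebra ℂ G)
    {x : MonoidAlgebra ℂ G | ∃ h : H,
      x = single (h : G) (1 : ℂ) - (χ h : ℂ) • (1 : MonoidAlgebra ℂ G)}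

@[simp]
lemma coord_single (g : G) (c : ℂ) : coord H χ (single g c) = c • cosetCoord H χ g := by
  simp [coord]

lemma cosetCoord_mul (g : G) (h : H) :
    cosetCoord H χ (g * h) = (χ h : ℂ) • cosetCoord H χ g := by
  have e : ((g * h : G) : G ⧸ H) = g := QuotientGroup.mk_mul_of_mem g h.2
  have key : ∀ q : G ⧸ H, ∀ (h₁ : q.out⁻¹ * (g * h) ∈ H) (h₂ : q.out⁻¹ * g ∈ H),
      (χ ⟨_, h₁⟩ : ℂ) = χ h * χ ⟨_, h₂⟩ := by
    intro q h₁ h₂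
    rw [mul_comm, ← Units.val_mul, ← map_mul]
    congr 3
    simp [mul_assoc]
  unfold cosetCoord
  rw [Finsupp.smul_single, smul_eq_mul]
  generalize_proofs h₁ h₂
  revert h₁
  rw [e]
  intro h₁
  rw [key]

lemma coord_eq_zero_of_mem_relations {x : MonoidAlgebra ℂ G} (hx : x ∈ relations H χ) :
    coord H χ x = 0 := by
  suffices ∀ a, coord H χ (a * x) = 0 by simpa using this 1
  induction hx using Submodule.span_induction with
  | mem x hx =>
    obtain ⟨h, rfl⟩ := hx
    intro a
    induction a using MonoidAlgebra.induction_linear with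
    | zero => simp
    | add a b ha hb => rw [add_mul, map_add, ha, hb, add_zero]
    | single g c =>
      rw [mul_sub, mul_smul_comm, mul_one, single_mul_single, map_sub, map_smul, coord_single,
        coord_single, cosetCoord_mul, mul_one, smul_comm, sub_self]
  | zero => simp
  | add x y _ _ hx hy => intro a; rw [mul_add, map_add, hx, hy, add_zero]
  | smul b x _ hx => intro a; rw [smul_eq_mul, ← mul_assoc]; exact hx _

lemma mk_single_mul (g : G) (h : H) :
    (Submodule.Quotient.mk (single (g * h) (1 : ℂ)) : IndChar H χ) =
      (χ h : ℂ) • Submodule.Quotient.mk (single g (1 : ℂ)) := by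
  rw [← Submodule.Quotient.mk_smul, Submodule.Quotient.eq]
  have := (relations H χ).smul_mem (single g (1 : ℂ)) (Submodule.subset_span ⟨h, rfl⟩)
  rw [smul_eq_mul, mul_sub, single_mul_single, mul_one, mul_smul_comm, mul_one] at this
  exact this

lemma ofCoord_coord (a : MonoidAlgebra ℂ G) :
    ofCoord H χ (coord H χ a) = Submodule.Quotient.mk a := by
  induction a using MonoidAlgebra.induction_linear with
  | zero => simp
  | add a b ha hb => rw [map_add, map_add, ha, hb, Submodule.Quotient.mk_add]
  | single g c =>
    rw [coord_single, map_smul, cosetCoord, ofCoord, Finsupp.linearCombination_single,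
      ← mk_single_mul, ← Submodule.Quotient.mk_smul]
    simp

lemma coord_single_mul_apply {q : G ⧸ H} {x : G} (hx : x ∈ H) (a : MonoidAlgebra ℂ G) :
    coord H χ (single (q.out * x * q.out⁻¹) 1 * a) q = χ ⟨x, hx⟩ * coord H χ a q := by
  induction a using MonoidAlgebra.induction_linear with
  | zero => simp
  | add a b ha hb => rw [mul_add, map_add, map_add, Finsupp.add_apply, ha, hb, Finsupp.add_apply,
      mul_add]
  | single g c =>
    rw [single_mul_single, coord_single, coord_single, one_mul, Finsupp.smul_apply,
      Finsupp.smul_apply, smul_eq_mul, smul_eq_mul, mul_left_comm]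
    congr 1
    by_cases hg : (g : G ⧸ H) = q
    · obtain ⟨h, rfl⟩ : ∃ h : H, g = q.out * h :=
        ⟨⟨q.out⁻¹ * g, QuotientGroup.eq.1 (q.out_eq.trans hg.symm)⟩, by simp⟩
      have e : q.out * x * q.out⁻¹ * (q.out * h) = q.out * ((⟨x, hx⟩ * h : H) : G) := by
        simp [mul_assoc]
      rw [e, cosetCoord_mul, cosetCoord_mul]
      simp [mul_assoc]
    · have hg' : ((q.out * x * q.out⁻¹ * g : G) : G ⧸ H) ≠ q := by
        intro h
        apply hg
        rw [← q.out_eq] at h ⊢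
        have h := QuotientGroup.eq.1 h
        refine QuotientGroup.eq.2 ?_
        have := H.mul_mem h hx
        simpa [mul_assoc] using this
      rw [cosetCoord, cosetCoord, Finsupp.single_eq_of_ne' hg, Finsupp.single_eq_of_ne' hg',
        mul_zero]

lemma coord_apply_eq_zero
    (hχ : ∀ g : G, g ∉ H → ∃ (x : G) (hx : x ∈ H) (hgx : g * x * g⁻¹ ∈ H),
      χ ⟨g * x * g⁻¹, hgx⟩ ≠ χ ⟨x, hx⟩)
    {a : MonoidAlgebra ℂ G}
    (ha : Submodule.Quotient.mk a ∈ weightSpace H χ (IndChar H χ))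
    {q : G ⧸ H} (hq : q ≠ (1 : G)) : coord H χ a q = 0 := by
  have hout : q.out ∉ H := fun h => hq <| by
    rw [← q.out_eq]
    exact QuotientGroup.eq.2 (by simpa using h)
  obtain ⟨x, hx, hgx, hne⟩ := hχ _ hout
  have h := ha ⟨_, hgx⟩
  rw [← Submodule.Quotient.mk_smul, ← Submodule.Quotient.mk_smul, Submodule.Quotient.eq] at h
  have h := DFunLike.congr_fun (coord_eq_zero_of_mem_relations H χ h) q
  rw [map_sub, Finsupp.sub_apply, smul_eq_mul, coord_single_mul_apply H χ hx, map_smul,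
    Finsupp.smul_apply, smul_eq_mul, ← sub_mul, Finsupp.zero_apply, mul_eq_zero, sub_eq_zero] at h
  exact h.resolve_left fun h => hne (Units.ext h.symm)

end IndChar

/-- If `χ^g ≠ χ` on `H^g ∩ H` for every `g ∉ H`, then the weight space of `Ind_H^G χ`
with respect to `(H, χ)` is one-dimensional over `ℂ`. -/
theorem finrank_weightSpace_indChar_eq_one_of_conj_ne (G : Type*) [Group G]
    (H : Subgroup G) (χ : H →* ℂˣ)
    (hχ : ∀ g : G, g ∉ H →
      ∃ (x : G) (hx : x ∈ H) (hgx : g * x * g⁻¹ ∈ H),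
        χ ⟨g * x * g⁻¹, hgx⟩ ≠ χ ⟨x, hx⟩) :
    Module.finrank ℂ (weightSpace H χ (IndChar H χ)) = 1 := by
  have hmem : (Submodule.Quotient.mk 1 : IndChar H χ) ∈ weightSpace H χ (IndChar H χ) := by
    intro h
    have := IndChar.mk_single_mul H χ 1 h
    rw [← Submodule.Quotient.mk_smul]
    simpa [MonoidAlgebra.one_def] using this
  refine finrank_eq_one (⟨_, hmem⟩ : weightSpace H χ (IndChar H χ)) ?_ ?_
  · intro h
    have h := (Submodule.Quotient.mk_eq_zero _).1 (congrArg Subtype.val h)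
    have h := IndChar.coord_eq_zero_of_mem_relations H χ h
    simp [MonoidAlgebra.one_def, IndChar.cosetCoord] at h
  · rintro ⟨v, hv⟩
    obtain ⟨a, rfl⟩ := Submodule.Quotient.mk_surjective _ v
    have key : ∃ c : ℂ, IndChar.coord H χ a = c • IndChar.coord H χ 1 := by
      refine ⟨IndChar.coord H χ a (1 : G) / IndChar.coord H χ 1 (1 : G), ?_⟩
      ext q
      by_cases hq : q = (1 : G)
      · subst hq
        rw [Finsupp.smul_apply, smul_eq_mul, div_mul_cancel₀]
        simp [MonoidAlgebra.one_def, IndChar.cosetCoord]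
      · rw [IndChar.coord_apply_eq_zero H χ hχ hv hq, Finsupp.smul_apply,
          IndChar.coord_apply_eq_zero H χ hχ hmem hq, smul_zero]
    obtain ⟨c, hc⟩ := key
    refine ⟨c, Subtype.ext ?_⟩
    change c • (Submodule.Quotient.mk 1 : IndChar H χ) = Submodule.Quotient.mk a
    rw [← IndChar.ofCoord_coord, ← IndChar.ofCoord_coord, hc, map_smul]
end
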